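/- Suppose H is a [3]-graph on n ≥ 69 vertices such that every pair of non-adjacent vertices u, v satisfies d_{∂H}(u) + d_{∂H}(v) ≥ n + 65, and H contains no Hamiltonian Berge cycle. Let C = v_1, e_1, ..., v_ℓ, e_ℓ, v_1 be a longest Berge cycle in H with ℓ ∈ {n−1, n−2}, let u ∈ V(H) − V(C), let U_u ⊆ V(C) be a usable set for u with |U_u| ≥ d_C(u)/6, and let X = {v_{i+1} : v_i ∈ U_u ∩ B_1(C)}, where B_1(C) = {v : (n+65)/2 − 3 ≤ d_C(v) < 3n/4 + 13}. Then every vertex w ∈ X satisfies d_C(w) ≥ 3n/4 + 13 or d_C(w) < n/4 + 18 (i.e., X ⊆ B'(C) ∪ S'(C)). -/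

import Mathlib

/-- Two vertices are adjacent in the hypergraph with edge set `H`
if some edge contains both of them. -/
def HAdj {V : Type*} (H : Finset (Finset V)) (u v : V) : Prop :=
  u ≠ v ∧ ∃ e ∈ H, u ∈ e ∧ v ∈ e

/-- The degree of `u` in the 2-shadow `∂H`: the number of vertices adjacent to `u`. -/
noncomputable def shadowDeg {V : Type*} (H : Finset (Finset V)) (u : V) : ℕ :=
  {v | HAdj H u v}.ncard

/-- A `[3]`-graph: every edge has exactly 2 or 3 vertices. -/
def IsThreeGraph {V : Type*} (H : Finset (Finset V)) : Prop :=
  ∀ e ∈ H, e.card = 2 ∨ e.card = 3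

/-- A Berge cycle of length `t` in the hypergraph with edge set `H`:
`t` distinct vertices `vtx i` and `t` distinct edges `edge i` (indices mod `t`)
with `{vtx i, vtx (i+1)} ⊆ edge i` for every `i`. -/
structure BergeCycle {V : Type*} (H : Finset (Finset V)) (t : ℕ) where
  vtx : ZMod t → V
  edge : ZMod t → Finset V
  vtx_inj : Function.Injective vtx
  edge_inj : Function.Injective edge
  edge_mem : ∀ i, edge i ∈ H
  mem_fst : ∀ i, vtx i ∈ edge i
  mem_snd : ∀ i, vtx (i + 1) ∈ edge i

/-- `d_C(u)`: the number of vertices of the Berge cycle `C` adjacent to `u`. -/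
noncomputable def BergeCycle.dC {V : Type*} {H : Finset (Finset V)} {t : ℕ}
    (C : BergeCycle H t) (u : V) : ℕ :=
  {v | v ∈ Set.range C.vtx ∧ HAdj H u v}.ncard

/-- `H` contains a Hamiltonian Berge cycle, i.e. a Berge cycle whose
vertex set is all of `V`. -/
def HamiltonianBergeCycle {V : Type*} (H : Finset (Finset V)) : Prop :=
  ∃ (t : ℕ) (C : BergeCycle H t), Set.range C.vtx = Set.univ

/-- A set `U` of indices of vertices of the Berge cycle `C` is usable for `u`:
(1) for every `i ∈ U` there is an edge in `E(u, v_{i-1}) - {e_{i-2}}`;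
(2) any two distinct `i, j ∈ U` are non-consecutive on `C`;
(3) for every pair of distinct `i, j ∈ U` there are distinct edges
`e ∈ E(u, v_{i-1}) - {e_{i-2}}` and `e' ∈ E(u, v_{j-1}) - {e_{j-2}}`. -/
def Usable {V : Type*} {H : Finset (Finset V)} {t : ℕ} (C : BergeCycle H t) (u : V)
    (U : Set (ZMod t)) : Prop :=
  (∀ i ∈ U, ∃ e ∈ H, e ≠ C.edge (i - 2) ∧ u ∈ e ∧ C.vtx (i - 1) ∈ e) ∧
  (∀ i ∈ U, ∀ j ∈ U, i ≠ j → j ≠ i + 1 ∧ j ≠ i - 1) ∧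
  (∀ i ∈ U, ∀ j ∈ U, i ≠ j → ∃ e ∈ H, ∃ e' ∈ H, e ≠ e' ∧
    e ≠ C.edge (i - 2) ∧ u ∈ e ∧ C.vtx (i - 1) ∈ e ∧
    e' ≠ C.edge (j - 2) ∧ u ∈ e' ∧ C.vtx (j - 1) ∈ e')

/-- `CwBtw a b c` : on the cycle oriented clockwise, `b` lies strictly between
`a` and `c` on the clockwise arc from `a` to `c`. -/
def CwBtw {t : ℕ} (a b c : ZMod t) : Prop :=
  0 < (b - a).val ∧ (b - a).val < (c - a).val

/-- `e` is an `(i,j;k)`-bridge of the Berge cycle `C`. -/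
def IsBridge {V : Type*} [DecidableEq V] {H : Finset (Finset V)} {t : ℕ}
    (C : BergeCycle H t) (i j k : ZMod t) (e : Finset V) : Prop :=
  (CwBtw i k j ∧ ((e = C.edge (k + 1) ∧ e = {C.vtx i, C.vtx (k + 1), C.vtx (k + 2)}) ∨
                (e = C.edge (k - 1) ∧ e = {C.vtx j, C.vtx k, C.vtx (k - 1)}))) ∨
  (CwBtw j k i ∧ ((e = C.edge (k - 1) ∧ e = {C.vtx i, C.vtx k, C.vtx (k - 1)}) ∨
                (e = C.edge (k + 1) ∧ e = {C.vtx j, C.vtx (k + 1), C.vtx (k + 2)})))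

/-- `R(v_i, v_j)`: the set of bridges produced by the pair `{v_i, v_j}`,
i.e. all `(i,j;k)`-bridges over `k ∉ {i, j}`. -/
def RBridges {V : Type*} [DecidableEq V] {H : Finset (Finset V)} {t : ℕ}
    (C : BergeCycle H t) (i j : ZMod t) : Set (Finset V) :=
  {e | ∃ k : ZMod t, k ≠ i ∧ k ≠ j ∧ IsBridge C i j k e}


structure IsPath {V : Type*} (H : Finset (Finset V)) (p : ℕ → V) (f : ℕ → Finset V)
    (l : ℕ) : Prop where
  pinj : ∀ a ≤ l, ∀ b ≤ l, p a = p b → a = b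
  finj : ∀ a < l, ∀ b < l, f a = f b → a = b
  mem : ∀ m < l, f m ∈ H
  fst : ∀ m < l, p m ∈ f m
  snd : ∀ m < l, p (m + 1) ∈ f m

theorem IsPath.close {V : Type*} {H : Finset (Finset V)} {p : ℕ → V} {f : ℕ → Finset V}
    {l : ℕ} (hP : IsPath H p f l) {g : Finset V} (hg : g ∈ H)
    (hne : ∀ m < l, f m ≠ g) (h0 : p 0 ∈ g) (h1 : p l ∈ g) :
    Nonempty (BergeCycle H (l + 1)) := by
  have hv : ∀ i : ZMod (l + 1), i.val ≤ l := fun i => Nat.lt_succ_iff.1 (ZMod.val_lt i)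
  refine ⟨⟨fun i => p i.val, fun i => if i.val < l then f i.val else g, ?_, ?_, ?_, ?_, ?_⟩⟩
  · intro a b h
    exact ZMod.val_injective _ (hP.pinj _ (hv a) _ (hv b) h)
  · intro a b h
    have ha := hv a
    have hb := hv b
    apply ZMod.val_injective
    dsimp only at h
    split_ifs at h with h1 h2 h2
    · exact hP.finj _ h1 _ h2 h
    · exact absurd h (hne _ h1)
    · exact absurd h.symm (hne _ h2)
    · omega
  · intro i
    split_ifs with h
    · exact hP.mem _ h
    · exact hg
  · intro i
    split_ifs with h
    · exact hP.fst _ h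
    · have := hv i
      have : i.val = l := by omega
      rw [this]; exact h1
  · intro i
    split_ifs with h
    · have h5 : (i + 1).val = i.val + 1 := by
        have h6 : i + 1 = ((i.val + 1 : ℕ) : ZMod (l + 1)) := by
          push_cast
          rw [ZMod.natCast_zmod_val]
        rw [h6, ZMod.val_natCast_of_lt (by omega)]
      rw [h5]
      exact hP.snd _ h
    · have := hv i
      have h2 : i.val = l := by omega
      have : i + 1 = 0 := by
        have : i = ((l : ℕ) : ZMod (l + 1)) := by
          calc i = ((i.val : ℕ) : ZMod (l + 1)) := (ZMod.natCast_zmod_val i).symm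
            _ = _ := by rw [h2]
        rw [this]
        have := ZMod.natCast_self (l + 1)
        push_cast at this
        exact this
      rw [this, ZMod.val_zero]; exact h0

theorem IsPath.rotate {V : Type*} {H : Finset (Finset V)} {p : ℕ → V} {f : ℕ → Finset V}
    {l : ℕ} (hP : IsPath H p f l) {j : ℕ} (hj : j < l) {h : Finset V} (hh : h ∈ H)
    (hne : ∀ m < l, m ≠ j → f m ≠ h) (h0 : p j ∈ h) (h1 : p l ∈ h) :
    IsPath H (fun m => if m ≤ j then p m else p (l + j + 1 - m))
      (fun m => if m < j then f m else if m = j then h else f (l + j - m)) l := by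
  refine ⟨?_, ?_, ?_, ?_, ?_⟩
  · intro a ha b hb hab
    split_ifs at hab
    all_goals
      have := hP.pinj _ (by omega) _ (by omega) hab
      omega
  · intro a ha b hb hab
    split_ifs at hab
    all_goals first
      | omega
      | (have := hP.finj _ (by omega) _ (by omega) hab
         omega)
      | exact absurd hab (hne _ (by omega) (by omega))
      | exact absurd hab.symm (hne _ (by omega) (by omega))
  · intro m hm
    split_ifs
    · exact hP.mem _ hm
    · exact hh
    · exact hP.mem _ (by omega)
  · intro m hm
    split_ifs
    any_goals omega
    · exact hP.fst _ hm
    · subst m; exact h0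
    · have := hP.snd (l + j - m) (by omega)
      rwa [show l + j - m + 1 = l + j + 1 - m by omega] at this
  · intro m hm
    split_ifs
    any_goals omega
    · exact hP.snd _ hm
    · subst m
      rwa [show l + j + 1 - (j + 1) = l by omega]
    · have := hP.fst (l + j - m) (by omega)
      rwa [show l + j + 1 - (m + 1) = l + j - m by omega]

theorem IsPath.cross {V : Type*} {H : Finset (Finset V)} {p : ℕ → V} {f : ℕ → Finset V}
    {l : ℕ} (hP : IsPath H p f l) {j : ℕ} (hj : j < l) {h g : Finset V} (hh : h ∈ H)
    (hg : g ∈ H) (hgh : g ≠ h)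
    (hneh : ∀ m < l, m ≠ j → f m ≠ h) (hneg : ∀ m < l, m ≠ j → f m ≠ g)
    (h0 : p j ∈ h) (h1 : p l ∈ h) (h2 : p 0 ∈ g) (h3 : p (j + 1) ∈ g) :
    Nonempty (BergeCycle H (l + 1)) := by
  refine (hP.rotate hj hh hneh h0 h1).close hg ?_ ?_ ?_
  · intro m hm
    split_ifs
    · exact hneg _ hm (by omega)
    · exact hgh.symm
    · exact hneg _ (by omega) (by omega)
  · simpa using h2
  · rw [if_neg (by omega), show l + j + 1 - l = j + 1 by omega]
    exact h3

theorem card4 {V : Type*} {H : Finset (Finset V)} (h3 : IsThreeGraph H) {e : Finset V}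
    (he : e ∈ H) {a b c d : V} (ha : a ∈ e) (hb : b ∈ e) (hc : c ∈ e) (hd : d ∈ e)
    (hab : a ≠ b) (hac : a ≠ c) (had : a ≠ d) (hbc : b ≠ c) (hbd : b ≠ d) (hcd : c ≠ d) :
    False := by
  classical
  have hs : ({a, b, c, d} : Finset V) ⊆ e := by
    intro x hx
    simp only [Finset.mem_insert, Finset.mem_singleton] at hx
    rcases hx with rfl | rfl | rfl | rfl <;> assumption
  have h4 : ({a, b, c, d} : Finset V).card = 4 := by
    rw [Finset.card_insert_of_notMem (by simp [*]), Finset.card_insert_of_notMem (by simp [*]),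
      Finset.card_pair hcd]
  have := Finset.card_le_card hs
  rcases h3 e he with h | h <;> omega

open Classical in
theorem IsPath.ore {V : Type*} {H : Finset (Finset V)} (h3 : IsThreeGraph H)
    {p : ℕ → V} {f : ℕ → Finset V}
    {l : ℕ} (hP : IsPath H p f l) (hl : 4 ≤ l) (hno : ¬ Nonempty (BergeCycle H (l + 1))) :
    ((Finset.range (l + 1)).filter (fun k => HAdj H (p 0) (p k))).card +
    ((Finset.range (l + 1)).filter (fun k => HAdj H (p l) (p k))).card ≤
    l + 2 + ((Finset.range l).filter (fun m => p 0 ∈ f m)).card +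
      ((Finset.range l).filter (fun m => p l ∈ f m)).card := by
  -- j ranges over [1, l-2]; p 0 ~ p (j+1), p l ~ p j
  set J := Finset.Icc 1 (l - 2) with hJ
  set X := J.filter (fun j => HAdj H (p 0) (p (j + 1))) with hX
  set Y := J.filter (fun j => HAdj H (p l) (p j)) with hY
  set A := (Finset.range l).filter (fun m => p 0 ∈ f m) with hA
  set B := (Finset.range l).filter (fun m => p l ∈ f m) with hB
  set X1 := X.filter (fun j => ∃ m < l, m ≠ j ∧ p 0 ∈ f m ∧ p (j + 1) ∈ f m) with hX1
  set Y1 := Y.filter (fun j => ∃ m < l, m ≠ j ∧ p l ∈ f m ∧ p j ∈ f m) with hY1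
  have pne : ∀ a ≤ l, ∀ b ≤ l, a ≠ b → p a ≠ p b := fun a ha b hb hab h => hab (hP.pinj a ha b hb h)
  have hX1c : X1.card ≤ A.card := by
    have hch : ∀ j ∈ X1, ∃ m < l, m ≠ j ∧ p 0 ∈ f m ∧ p (j + 1) ∈ f m := fun j hj =>
      (Finset.mem_filter.1 hj).2
    choose! φ h1 h2 h4 h5 using hch
    have hr : ∀ j ∈ X1, 1 ≤ j ∧ j ≤ l - 2 := fun j hj =>
      Finset.mem_Icc.1 (Finset.mem_filter.1 (Finset.mem_filter.1 hj).1).1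
    refine Finset.card_le_card_of_injOn φ (fun j hj => ?_) ?_
    · exact Finset.mem_coe.2 (Finset.mem_filter.2 ⟨Finset.mem_range.2 (h1 j hj), h4 j hj⟩)
    · have key : ∀ j ∈ X1, φ j ≠ 0 → φ j = j + 1 := by
        intro j hj h0
        by_contra hc
        have := hr j hj
        have := h1 j hj
        have := h2 j hj
        exact card4 h3 (hP.mem _ (h1 j hj)) (h4 j hj) (h5 j hj) (hP.fst _ (h1 j hj))
          (hP.snd _ (h1 j hj)) (pne _ (by omega) _ (by omega) (by omega))
          (pne _ (by omega) _ (by omega) (by omega)) (pne _ (by omega) _ (by omega) (by omega))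
          (pne _ (by omega) _ (by omega) (by omega)) (pne _ (by omega) _ (by omega) (by omega))
          (pne _ (by omega) _ (by omega) (by omega))
      intro a ha b hb hab
      have ha' := Finset.mem_coe.1 ha
      have hb' := Finset.mem_coe.1 hb
      by_cases h0 : φ a = 0
      · by_contra hne
        have := hr a ha'
        have := hr b hb'
        have hb5 := h5 b hb'
        rw [← hab] at hb5
        have hs := hP.snd _ (h1 a ha')
        rw [h0] at hs
        exact card4 h3 (hP.mem _ (h1 a ha')) (h4 a ha') (h5 a ha') hb5 (h0 ▸ hs)
          (pne _ (by omega) _ (by omega) (by omega)) (pne _ (by omega) _ (by omega) (by omega))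
          (pne _ (by omega) _ (by omega) (by omega)) (pne _ (by omega) _ (by omega) (by omega))
          (pne _ (by omega) _ (by omega) (by omega)) (pne _ (by omega) _ (by omega) (by omega))
      · have := key a ha' h0
        have := key b hb' (hab ▸ h0)
        omega
  have hY1c : Y1.card ≤ B.card := by
    have hch : ∀ j ∈ Y1, ∃ m < l, m ≠ j ∧ p l ∈ f m ∧ p j ∈ f m := fun j hj =>
      (Finset.mem_filter.1 hj).2
    choose! φ h1 h2 h4 h5 using hch
    have hr : ∀ j ∈ Y1, 1 ≤ j ∧ j ≤ l - 2 := fun j hj =>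
      Finset.mem_Icc.1 (Finset.mem_filter.1 (Finset.mem_filter.1 hj).1).1
    refine Finset.card_le_card_of_injOn φ (fun j hj => ?_) ?_
    · exact Finset.mem_coe.2 (Finset.mem_filter.2 ⟨Finset.mem_range.2 (h1 j hj), h4 j hj⟩)
    · have key : ∀ j ∈ Y1, φ j ≠ l - 1 → φ j + 1 = j := by
        intro j hj h0
        by_contra hc
        have := hr j hj
        have := h1 j hj
        have := h2 j hj
        exact card4 h3 (hP.mem _ (h1 j hj)) (h4 j hj) (h5 j hj) (hP.fst _ (h1 j hj))
          (hP.snd _ (h1 j hj)) (pne _ (by omega) _ (by omega) (by omega))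
          (pne _ (by omega) _ (by omega) (by omega)) (pne _ (by omega) _ (by omega) (by omega))
          (pne _ (by omega) _ (by omega) (by omega)) (pne _ (by omega) _ (by omega) (by omega))
          (pne _ (by omega) _ (by omega) (by omega))
      intro a ha b hb hab
      have ha' := Finset.mem_coe.1 ha
      have hb' := Finset.mem_coe.1 hb
      by_cases h0 : φ a = l - 1
      · by_contra hne
        have := hr a ha'
        have := hr b hb'
        have hb5 := h5 b hb'
        rw [← hab] at hb5
        exact card4 h3 (hP.mem _ (h1 a ha')) (h4 a ha') (h5 a ha') hb5 (hP.fst _ (h1 a ha'))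
          (pne _ (by omega) _ (by omega) (by omega)) (pne _ (by omega) _ (by omega) (by omega))
          (pne _ (by omega) _ (by omega) (by omega)) (pne _ (by omega) _ (by omega) (by omega))
          (pne _ (by omega) _ (by omega) (by omega)) (pne _ (by omega) _ (by omega) (by omega))
      · have := key a ha' h0
        have := key b hb' (hab ▸ h0)
        omega
  have hdisj : Disjoint (X \ X1) (Y \ Y1) := by
    rw [Finset.disjoint_left]
    intro j hjx hjy
    obtain ⟨hx, hx1⟩ := Finset.mem_sdiff.1 hjx
    obtain ⟨hy, hy1⟩ := Finset.mem_sdiff.1 hjy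
    obtain ⟨hjJ, hadx⟩ := Finset.mem_filter.1 hx
    obtain ⟨-, hady⟩ := Finset.mem_filter.1 hy
    have hj := Finset.mem_Icc.1 hjJ
    obtain ⟨-, g, hgH, hg0, hg1⟩ := hadx
    obtain ⟨-, h, hhH, hh0, hh1⟩ := hady
    apply hno
    refine hP.cross (j := j) (by omega) hhH hgH ?_ ?_ ?_ hh1 hh0 hg0 hg1
    · rintro rfl
      exact card4 h3 hgH hg0 hg1 hh0 hh1
          (pne _ (by omega) _ (by omega) (by omega)) (pne _ (by omega) _ (by omega) (by omega))
          (pne _ (by omega) _ (by omega) (by omega)) (pne _ (by omega) _ (by omega) (by omega))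
          (pne _ (by omega) _ (by omega) (by omega)) (pne _ (by omega) _ (by omega) (by omega))
    · rintro m hm hmj rfl
      exact hy1 (Finset.mem_filter.2 ⟨hy, m, hm, hmj, hh0, hh1⟩)
    · rintro m hm hmj rfl
      exact hx1 (Finset.mem_filter.2 ⟨hx, m, hm, hmj, hg0, hg1⟩)
  have hsum : (X \ X1).card + (Y \ Y1).card ≤ l - 2 := by
    rw [← Finset.card_union_of_disjoint hdisj]
    have : (X \ X1) ∪ (Y \ Y1) ⊆ J := by
      intro j hj
      rcases Finset.mem_union.1 hj with h | h
      · exact (Finset.mem_filter.1 (Finset.mem_sdiff.1 h).1).1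
      · exact (Finset.mem_filter.1 (Finset.mem_sdiff.1 h).1).1
    have h := Finset.card_le_card this
    rw [hJ, Nat.card_Icc] at h
    omega
  have hXc : X.card ≤ (X \ X1).card + X1.card := by
    have := Finset.le_card_sdiff X1 X
    omega
  have hYc : Y.card ≤ (Y \ Y1).card + Y1.card := by
    have := Finset.le_card_sdiff Y1 Y
    omega
  have hN0 : ((Finset.range (l + 1)).filter (fun k => HAdj H (p 0) (p k))).card ≤ X.card + 2 := by
    have hsub : (Finset.range (l + 1)).filter (fun k => HAdj H (p 0) (p k)) ⊆
        X.image (fun j => j + 1) ∪ {1, l} := by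
      intro k hk
      obtain ⟨hk1, hk2⟩ := Finset.mem_filter.1 hk
      have hkr := Finset.mem_range.1 hk1
      have hk0 : k ≠ 0 := by
        rintro rfl
        exact hk2.1 rfl
      simp only [Finset.mem_union, Finset.mem_image, Finset.mem_insert, Finset.mem_singleton]
      by_cases h1 : k = 1
      · simp [h1]
      by_cases h2 : k = l
      · simp [h2]
      left
      refine ⟨k - 1, Finset.mem_filter.2 ⟨Finset.mem_Icc.2 ⟨by omega, by omega⟩, ?_⟩, by omega⟩
      rwa [show k - 1 + 1 = k by omega]
    refine (Finset.card_le_card hsub).trans ((Finset.card_union_le _ _).trans ?_)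
    exact add_le_add Finset.card_image_le Finset.card_le_two
  have hNl : ((Finset.range (l + 1)).filter (fun k => HAdj H (p l) (p k))).card ≤ Y.card + 2 := by
    have hsub : (Finset.range (l + 1)).filter (fun k => HAdj H (p l) (p k)) ⊆
        Y ∪ {0, l - 1} := by
      intro k hk
      obtain ⟨hk1, hk2⟩ := Finset.mem_filter.1 hk
      have hkr := Finset.mem_range.1 hk1
      have hk0 : k ≠ l := by
        rintro rfl
        exact hk2.1 rfl
      simp only [Finset.mem_union, Finset.mem_insert, Finset.mem_singleton]
      by_cases h1 : k = 0
      · simp [h1]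
      by_cases h2 : k = l - 1
      · simp [h2]
      left
      exact Finset.mem_filter.2 ⟨Finset.mem_Icc.2 ⟨by omega, by omega⟩, hk2⟩
    refine (Finset.card_le_card hsub).trans ((Finset.card_union_le _ _).trans ?_)
    exact add_le_add le_rfl Finset.card_le_two
  omega


theorem cast_inj_lt {t : ℕ} (b : ZMod t) {x y : ℕ} (hx : x < t) (hy : y < t)
    (h : b + (x : ZMod t) = b + (y : ZMod t)) : x = y := by
  have h1 := add_left_cancel h
  rw [ZMod.natCast_eq_natCast_iff'] at h1
  rwa [Nat.mod_eq_of_lt hx, Nat.mod_eq_of_lt hy] at h1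

theorem cast_sub_eq {t : ℕ} {a b : ℕ} (h : a + b = t) : ((a : ℕ) : ZMod t) = -(b : ZMod t) := by
  have h1 : ((a + b : ℕ) : ZMod t) = 0 := by rw [h]; exact ZMod.natCast_self t
  push_cast at h1
  exact eq_neg_of_add_eq_zero_left h1

theorem zne {t : ℕ} {a : ℕ} (h0 : 0 < a) (h : a < t) : ((a : ℕ) : ZMod t) ≠ 0 := by
  intro h1
  have h2 := (ZMod.natCast_eq_zero_iff a t).1 h1
  exact absurd (Nat.le_of_dvd h0 h2) (by omega)

theorem ne_succ {t : ℕ} (ht : 10 ≤ t) (m : ZMod t) : m ≠ m + 1 := by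
  intro h
  have := zne (t := t) (a := 1) (by omega) (by omega)
  apply this
  push_cast
  exact left_eq_add.1 h

theorem exists_lin {t : ℕ} (ht : 10 ≤ t) (b k : ZMod t) : ∃ m : ℕ, m < t ∧ k = b + (m : ZMod t) := by
  have : NeZero t := ⟨by omega⟩
  exact ⟨(k - b).val, ZMod.val_lt _, by rw [ZMod.natCast_zmod_val]; ring⟩

theorem off_edge {V : Type*} {H : Finset (Finset V)} (h3 : IsThreeGraph H) {t : ℕ} (ht : 10 ≤ t)
    (C : BergeCycle H t) {x : V} (hx : x ∉ Set.range C.vtx) {k m : ZMod t}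
    (h1 : x ∈ C.edge m) (h2 : C.vtx k ∈ C.edge m) : k = m ∨ k = m + 1 := by
  by_contra hc
  push Not at hc
  have hxn : ∀ j, x ≠ C.vtx j := fun j h => hx ⟨j, h.symm⟩
  exact card4 h3 (C.edge_mem m) h1 h2 (C.mem_fst m) (C.mem_snd m) (hxn _) (hxn _) (hxn _)
    (fun h => hc.1 (C.vtx_inj h)) (fun h => hc.2 (C.vtx_inj h))
    (fun h => ne_succ ht m (C.vtx_inj h))

theorem on_edge {V : Type*} {H : Finset (Finset V)} (h3 : IsThreeGraph H) {t : ℕ} (ht : 10 ≤ t)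
    (C : BergeCycle H t) {j k m : ZMod t} (hjk : j ≠ k)
    (h1 : C.vtx j ∈ C.edge m) (h2 : C.vtx k ∈ C.edge m) :
    j = m ∨ j = m + 1 ∨ k = m ∨ k = m + 1 := by
  by_contra hc
  push Not at hc
  exact card4 h3 (C.edge_mem m) h1 h2 (C.mem_fst m) (C.mem_snd m)
    (fun h => hjk (C.vtx_inj h))
    (fun h => hc.1 (C.vtx_inj h)) (fun h => hc.2.1 (C.vtx_inj h))
    (fun h => hc.2.2.1 (C.vtx_inj h)) (fun h => hc.2.2.2 (C.vtx_inj h))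
    (fun h => ne_succ ht m (C.vtx_inj h))

open Classical in
/-- edges of the cycle whose third vertex is `v_j` -/
noncomputable def aS {V : Type*} {H : Finset (Finset V)} {t : ℕ} [NeZero t]
    (C : BergeCycle H t) (j : ZMod t) : Finset (ZMod t) :=
  Finset.univ.filter (fun m => m ≠ j ∧ m ≠ j - 1 ∧ C.vtx j ∈ C.edge m)

theorem aS_disj {V : Type*} {H : Finset (Finset V)} (h3 : IsThreeGraph H) {t : ℕ} [NeZero t]
    (ht : 10 ≤ t) (C : BergeCycle H t) {j k : ZMod t} (hjk : j ≠ k) :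
    Disjoint (aS C j) (aS C k) := by
  rw [Finset.disjoint_left]
  intro m hj hk
  simp only [aS, Finset.mem_filter, Finset.mem_univ, true_and] at hj hk
  rcases on_edge h3 ht C hjk hj.2.2 hk.2.2 with h | h | h | h
  · exact hj.1 h.symm
  · exact hj.2.1 (by rw [h]; ring)
  · exact hk.1 h.symm
  · exact hk.2.1 (by rw [h]; ring)

theorem aS_sum {V : Type*} {H : Finset (Finset V)} (h3 : IsThreeGraph H) {t : ℕ} [NeZero t]
    (ht : 10 ≤ t) (C : BergeCycle H t) (S : Finset (ZMod t)) (r : ℕ)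
    (hS : ∀ j ∈ S, r ≤ (aS C j).card) : S.card * r ≤ t := by
  classical
  have h1 : (S.biUnion (fun j => aS C j)).card = ∑ j ∈ S, (aS C j).card :=
    Finset.card_biUnion (fun j _ k _ hjk => aS_disj h3 ht C hjk)
  have h2 : (S.biUnion (fun j => aS C j)).card ≤ t := by
    refine (Finset.card_le_univ _).trans ?_
    rw [ZMod.card]
  have h4 : S.card • r ≤ ∑ j ∈ S, (aS C j).card := Finset.card_nsmul_le_sum _ _ _ hS
  rw [smul_eq_mul] at h4
  omega

open Classical in
theorem alpha_le {V : Type*} {H : Finset (Finset V)} {t : ℕ} [NeZero t]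
    (C : BergeCycle H t) {p : ℕ → V} {f : ℕ → Finset V} {l : ℕ} (hP : IsPath H p f l)
    {g1 g2 : Finset V} (hf : ∀ m < l, f m = g1 ∨ f m = g2 ∨ ∃ k, f m = C.edge k)
    {x : V} (j : ZMod t) (hx : x = C.vtx j) :
    ((Finset.range l).filter (fun m => x ∈ f m)).card ≤ (aS C j).card + 4 := by
  have h1 : ((Finset.range l).filter (fun m => x ∈ f m)).card ≤
      ((aS C j).image C.edge ∪ {C.edge j, C.edge (j - 1), g1, g2}).card := by
    refine Finset.card_le_card_of_injOn f ?_ ?_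
    · intro m hm
      obtain ⟨hm1, hm2⟩ := Finset.mem_filter.1 (Finset.mem_coe.1 hm)
      simp only [Finset.coe_union, Set.mem_union, Finset.mem_coe, Finset.mem_image,
        Finset.mem_insert, Finset.mem_singleton]
      rcases hf m (Finset.mem_range.1 hm1) with h | h | ⟨k, h⟩
      · simp [h]
      · simp [h]
      · by_cases hk1 : k = j
        · subst hk1; simp [h]
        by_cases hk2 : k = j - 1
        · subst hk2; simp [h]
        left
        refine ⟨k, ?_, h.symm⟩
        simp only [aS, Finset.mem_filter, Finset.mem_univ, true_and]
        exact ⟨hk1, hk2, by rw [← h, ← hx]; exact hm2⟩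
    · intro a ha b hb hab
      exact hP.finj _ (Finset.mem_range.1 (Finset.mem_filter.1 (Finset.mem_coe.1 ha)).1) _
        (Finset.mem_range.1 (Finset.mem_filter.1 (Finset.mem_coe.1 hb)).1) hab
  refine h1.trans ((Finset.card_union_le _ _).trans (add_le_add Finset.card_image_le ?_))
  exact Finset.card_le_four

open Classical in
theorem shadow_le_path {V : Type*} [Fintype V] {H : Finset (Finset V)} {p : ℕ → V}
    {f : ℕ → Finset V} {l : ℕ} (hP : IsPath H p f l) (x : V) :
    shadowDeg H x + (l + 1) ≤
      ((Finset.range (l + 1)).filter (fun k => HAdj H x (p k))).card + Fintype.card V := by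
  set R := (Finset.range (l + 1)).image p with hR
  have hRc : R.card = l + 1 := by
    rw [hR, Finset.card_image_of_injOn, Finset.card_range]
    intro a ha b hb hab
    have ha := Finset.mem_range.1 (Finset.mem_coe.1 ha)
    have hb := Finset.mem_range.1 (Finset.mem_coe.1 hb)
    exact hP.pinj a (by omega) b (by omega) hab
  have h1 : shadowDeg H x = (Finset.univ.filter (fun v => HAdj H x v)).card := by
    rw [shadowDeg, ← Set.ncard_coe_finset]
    congr 1
    ext v
    simp
  have h2 : Finset.univ.filter (fun v => HAdj H x v) ⊆
      ((Finset.range (l + 1)).filter (fun k => HAdj H x (p k))).image p ∪ Rᶜ := by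
    intro v hv
    have hv := (Finset.mem_filter.1 hv).2
    by_cases hvR : v ∈ R
    · obtain ⟨k, hk, rfl⟩ := Finset.mem_image.1 hvR
      exact Finset.mem_union_left _ (Finset.mem_image_of_mem _ (Finset.mem_filter.2 ⟨hk, hv⟩))
    · exact Finset.mem_union_right _ (Finset.mem_compl.2 hvR)
  have h3 := (Finset.card_le_card h2).trans (Finset.card_union_le _ _)
  have h4 : R.card + Rᶜ.card = Fintype.card V := Finset.card_add_card_compl R
  have h5 : (((Finset.range (l + 1)).filter (fun k => HAdj H x (p k))).image p).card ≤ _ :=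
    Finset.card_image_le
  omega

/-- `v_{k+1}, ..., v_k, x` -/
theorem path0 {V : Type*} {H : Finset (Finset V)} {t : ℕ} (ht : 10 ≤ t)
    (C : BergeCycle H t) {x : V} (hx : x ∉ Set.range C.vtx) (k : ZMod t) {F : Finset V}
    (hF : F ∈ H) (hxF : x ∈ F) (hkF : C.vtx k ∈ F) (hne : ∀ m, m ≠ k → C.edge m ≠ F) :
    IsPath H (fun m => if m < t then C.vtx (k + 1 + (m : ZMod t)) else x)
      (fun m => if m < t - 1 then C.edge (k + 1 + (m : ZMod t)) else F) t := by
  have hxn : ∀ j, C.vtx j ≠ x := fun j h => hx ⟨j, h⟩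
  have hlast : k + 1 + ((t - 1 : ℕ) : ZMod t) = k := by
    rw [cast_sub_eq (t := t) (a := t - 1) (b := 1) (by omega)]
    push_cast; ring
  have hne' : ∀ m : ℕ, m < t - 1 → C.edge (k + 1 + (m : ZMod t)) ≠ F := by
    intro m hm
    apply hne
    intro h
    have := cast_inj_lt (k + 1) (by omega) (by omega) (h.trans hlast.symm)
    omega
  refine ⟨?_, ?_, ?_, ?_, ?_⟩
  · intro a ha b hb hab
    try dsimp only at hab
    split_ifs at hab with h1 h2 h2
    · exact cast_inj_lt _ h1 h2 (C.vtx_inj hab)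
    · exact absurd hab (hxn _)
    · exact absurd hab.symm (hxn _)
    · omega
  · intro a ha b hb hab
    try dsimp only at hab
    split_ifs at hab with h1 h2 h2
    · exact cast_inj_lt _ (by omega) (by omega) (C.edge_inj hab)
    · exact absurd hab (hne' _ h1)
    · exact absurd hab.symm (hne' _ h2)
    · omega
  · intro m hm
    try dsimp only
    split_ifs
    · exact C.edge_mem _
    · exact hF
  · intro m hm
    try dsimp only
    rw [if_pos hm]
    split_ifs with h
    · exact C.mem_fst _
    · have : m = t - 1 := by omega
      subst this
      rwa [hlast]
  · intro m hm
    try dsimp only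
    split_ifs with h1 h2 h2
    · have := C.mem_snd (k + 1 + (m : ZMod t))
      push_cast
      rwa [← add_assoc]
    · omega
    · omega
    · exact hxF

theorem path1 {V : Type*} {H : Finset (Finset V)} {t : ℕ} (ht : 10 ≤ t)
    (C : BergeCycle H t) {x : V} (hx : x ∉ Set.range C.vtx) {k k' : ZMod t} (hkk : k ≠ k')
    {F F' : Finset V} (hFF : F ≠ F')
    (hF : F ∈ H) (hxF : x ∈ F) (hkF : C.vtx k ∈ F) (hne : ∀ m, m ≠ k → C.edge m ≠ F)
    (hF' : F' ∈ H) (hxF' : x ∈ F') (hkF' : C.vtx k' ∈ F')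
    (hne' : ∀ m, m ≠ k' → C.edge m ≠ F') :
    ∃ (p : ℕ → V) (f : ℕ → Finset V), IsPath H p f t ∧ p 0 = C.vtx (k + 1) ∧
      p t = C.vtx (k' + 1) ∧
      ∀ m < t, f m = F ∨ f m = F' ∨ ∃ j, j ≠ k ∧ j ≠ k' ∧ f m = C.edge j := by
  have hlast : k + 1 + ((t - 1 : ℕ) : ZMod t) = k := by
    rw [cast_sub_eq (t := t) (a := t - 1) (b := 1) (by omega)]
    push_cast; ring
  obtain ⟨a, hat, hka⟩ := exists_lin ht (k + 1) k'
  have ha1 : a ≠ t - 1 := by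
    rintro rfl
    rw [hlast] at hka
    exact hkk hka.symm
  have hjk : ∀ m : ℕ, m < t - 1 → k + 1 + (m : ZMod t) ≠ k := by
    intro m hm h
    have := cast_inj_lt (k + 1) (by omega) (by omega) (h.trans hlast.symm)
    omega
  have hjk' : ∀ m : ℕ, m < t → m ≠ a → k + 1 + (m : ZMod t) ≠ k' := by
    intro m hm hma h
    rw [hka] at h
    exact hma (cast_inj_lt _ hm hat h)
  have h0 := path0 ht C hx k hF hxF hkF hne
  refine ⟨_, _, h0.rotate (j := a) (by omega) hF' ?_ ?_ ?_, ?_, ?_, ?_⟩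
  · intro m hm hma
    try dsimp only
    split_ifs with h
    · exact hne' _ (hjk' m hm hma)
    · exact hFF
  · try dsimp only
    rw [if_pos hat, ← hka]; exact hkF'
  · try dsimp only
    rw [if_neg (by omega)]; exact hxF'
  · try dsimp only
    rw [if_pos (by omega), if_pos (by omega)]
    simp
  · try dsimp only
    rw [if_neg (by omega), show t + a + 1 - t = a + 1 by omega, if_pos (by omega), hka]
    push_cast
    rw [← add_assoc]
  · intro m hm
    try dsimp only
    split_ifs with h1 h2 h3 h4
    · exact Or.inr (Or.inr ⟨_, hjk m h2, hjk' m hm (by omega), rfl⟩)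
    · exact Or.inl rfl
    · exact Or.inr (Or.inl rfl)
    · exact Or.inr (Or.inr ⟨_, hjk _ h4, hjk' _ (by omega) (by omega), rfl⟩)
    · exact Or.inl rfl


theorem pair_adj {V : Type*} [Fintype V] {H : Finset (Finset V)} (h3 : IsThreeGraph H)
    (hOre : ∀ u v : V, u ≠ v → ¬ HAdj H u v →
      Fintype.card V + 65 ≤ shadowDeg H u + shadowDeg H v)
    {t : ℕ} [NeZero t] (ht : 10 ≤ t) (hn : Fintype.card V ≤ t + 2)
    (hno : ¬ Nonempty (BergeCycle H (t + 1)))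
    (C : BergeCycle H t) {x : V} (hx : x ∉ Set.range C.vtx) {k k' : ZMod t} (hkk : k ≠ k')
    {F F' : Finset V} (hFF : F ≠ F')
    (hF : F ∈ H) (hxF : x ∈ F) (hkF : C.vtx k ∈ F) (hne : ∀ m, m ≠ k → C.edge m ≠ F)
    (hF' : F' ∈ H) (hxF' : x ∈ F') (hkF' : C.vtx k' ∈ F')
    (hne' : ∀ m, m ≠ k' → C.edge m ≠ F')
    (hs : (aS C (k + 1)).card ≤ 27) (hs' : (aS C (k' + 1)).card ≤ 27) :
    C.vtx (k' + 1) ∈ C.edge (k + 1) ∨ C.vtx (k + 1) ∈ C.edge (k' + 1) := by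
  classical
  obtain ⟨p, f, hP, hp0, hpt, hf⟩ := path1 ht C hx hkk hFF hF hxF hkF hne hF' hxF' hkF' hne'
  have hxn : ∀ j, x ≠ C.vtx j := fun j h => hx ⟨j, h.symm⟩
  have hvn : ∀ {a b}, a ≠ b → C.vtx a ≠ C.vtx b := fun hab h => hab (C.vtx_inj h)
  have hk1 : k + 1 ≠ k' + 1 := fun h => hkk (add_right_cancel h)
  have hvne : C.vtx (k + 1) ≠ C.vtx (k' + 1) := hvn hk1
  by_cases had : HAdj H (C.vtx (k + 1)) (C.vtx (k' + 1))
  · obtain ⟨-, g, hg, hg0, hg1⟩ := had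
    have : ∃ m < t, f m = g := by
      by_contra hc
      push Not at hc
      exact hno (hP.close hg hc (hp0 ▸ hg0) (hpt ▸ hg1))
    obtain ⟨m, hm, rfl⟩ := this
    rcases hf m hm with h | h | ⟨j, hjk, hjk', h⟩
    · rw [h] at hg0 hg1
      by_cases hc : k = k' + 1
      · right; rw [← hc]; exact C.mem_snd k
      · exact (card4 h3 hF hxF hkF hg0 hg1 (hxn _) (hxn _) (hxn _) (hvn (ne_succ ht k)) (hvn hc)
          hvne).elim
    · rw [h] at hg0 hg1
      by_cases hc : k' = k + 1
      · left; rw [← hc]; exact C.mem_snd k'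
      · exact (card4 h3 hF' hxF' hkF' hg0 hg1 (hxn _) (hxn _) (hxn _) (hvn hc)
          (hvn (ne_succ ht k')) hvne).elim
    · rw [h] at hg0 hg1
      rcases on_edge h3 ht C hk1 hg0 hg1 with h | h | h | h
      · left; rw [h]; exact hg1
      · exact absurd (add_right_cancel h).symm hjk
      · right; rw [h]; exact hg0
      · exact absurd (add_right_cancel h).symm hjk'
  · exfalso
    have h1 := hOre _ _ hvne had
    have h2 := hP.ore h3 (by omega) hno
    have hf2 : ∀ m < t, f m = F ∨ f m = F' ∨ ∃ k, f m = C.edge k := by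
      intro m hm
      rcases hf m hm with h | h | ⟨j, -, -, h⟩
      · exact Or.inl h
      · exact Or.inr (Or.inl h)
      · exact Or.inr (Or.inr ⟨j, h⟩)
    have h4 := alpha_le C hP hf2 (k + 1) hp0
    have h5 := alpha_le C hP hf2 (k' + 1) hpt
    have h6 := shadow_le_path hP (p 0)
    have h7 := shadow_le_path hP (p t)
    rw [← hp0, ← hpt] at h1
    omega

theorem tour {α : Type*} [DecidableEq α] (T : Finset α) (R : α → α → Prop) [DecidableRel R]
    (h1 : ∀ a ∈ T, ∀ b ∈ T, a ≠ b → R a b ∨ R b a)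
    (h2 : ∀ a ∈ T, (T.filter (fun b => a ≠ b ∧ R a b)).card ≤ 2) : T.card ≤ 5 := by
  set P := (T ×ˢ T).filter (fun z => z.1 ≠ z.2 ∧ R z.1 z.2) with hP
  have hPc : P.card ≤ T.card * 2 := by
    rw [hP, Finset.card_filter, Finset.sum_product]
    refine Finset.sum_le_card_nsmul T _ 2 (fun a ha => ?_)
    rw [← Finset.card_filter]
    exact h2 a ha
  have hsub : T.offDiag ⊆ P ∪ P.image Prod.swap := by
    rintro ⟨a, b⟩ hab
    obtain ⟨ha, hb, hne⟩ := Finset.mem_offDiag.1 hab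
    rw [Finset.mem_union]
    rcases h1 a ha b hb hne with h | h
    · left
      exact Finset.mem_filter.2 ⟨Finset.mem_product.2 ⟨ha, hb⟩, hne, h⟩
    · right
      refine Finset.mem_image.2 ⟨(b, a), ?_, rfl⟩
      exact Finset.mem_filter.2 ⟨Finset.mem_product.2 ⟨hb, ha⟩, hne.symm, h⟩
  have h3 := (Finset.card_le_card hsub).trans (Finset.card_union_le _ _)
  have h4 : (P.image Prod.swap).card ≤ P.card := Finset.card_image_le
  rw [Finset.offDiag_card] at h3
  have h5 : T.card * T.card ≤ T.card * 5 := by omega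
  by_contra hc
  push Not at hc
  nlinarith

theorem lemS {V : Type*} [Fintype V] {H : Finset (Finset V)} (h3 : IsThreeGraph H)
    (hOre : ∀ u v : V, u ≠ v → ¬ HAdj H u v →
      Fintype.card V + 65 ≤ shadowDeg H u + shadowDeg H v)
    {t : ℕ} (ht : 10 ≤ t) (hn : Fintype.card V ≤ t + 2)
    (hno : ¬ Nonempty (BergeCycle H (t + 1)))
    (C : BergeCycle H t) {x : V} (hx : x ∉ Set.range C.vtx) (S : Finset (ZMod t))
    (F : ZMod t → Finset V) (hinj : Set.InjOn F S)
    (hF : ∀ k ∈ S, F k ∈ H ∧ x ∈ F k ∧ C.vtx k ∈ F k ∧ F k ≠ C.edge (k - 1)) :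
    28 * S.card ≤ 140 + t := by
  classical
  have : NeZero t := ⟨by omega⟩
  have hne : ∀ k ∈ S, ∀ m, m ≠ k → C.edge m ≠ F k := by
    intro k hk m hm h
    obtain ⟨h1, h2, h4, h5⟩ := hF k hk
    rw [← h] at h2 h4
    rcases off_edge h3 ht C hx h2 h4 with h6 | h6
    · exact hm h6.symm
    · exact h5 (by rw [← h, show k - 1 = m by rw [h6]; ring])
  set T := S.filter (fun k => (aS C (k + 1)).card ≤ 27) with hT
  have hT5 : T.card ≤ 5 := by
    refine tour T (fun k k' => C.vtx (k' + 1) ∈ C.edge (k + 1)) ?_ ?_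
    · intro k hk k' hk' hkk
      obtain ⟨hkS, hks⟩ := Finset.mem_filter.1 hk
      obtain ⟨hkS', hks'⟩ := Finset.mem_filter.1 hk'
      obtain ⟨a1, a2, a3, a4⟩ := hF k hkS
      obtain ⟨b1, b2, b3, b4⟩ := hF k' hkS'
      exact pair_adj h3 hOre ht hn hno C hx hkk (fun h => hkk (hinj hkS hkS' h))
        a1 a2 a3 (hne k hkS) b1 b2 b3 (hne k' hkS') hks hks'
    · intro k hk
      have h1 : (T.filter (fun b => k ≠ b ∧ C.vtx (b + 1) ∈ C.edge (k + 1))).card ≤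
          ((C.edge (k + 1)).erase (C.vtx (k + 1))).card := by
        refine Finset.card_le_card_of_injOn (fun b => C.vtx (b + 1)) ?_ ?_
        · intro b hb
          obtain ⟨-, hb1, hb2⟩ := Finset.mem_filter.1 (Finset.mem_coe.1 hb)
          exact Finset.mem_coe.2 (Finset.mem_erase.2
            ⟨fun h => hb1 (add_right_cancel (C.vtx_inj h)).symm, hb2⟩)
        · intro a _ b _ hab
          exact add_right_cancel (C.vtx_inj hab)
      rw [Finset.card_erase_of_mem (C.mem_fst _)] at h1
      rcases h3 _ (C.edge_mem (k + 1)) with h | h <;> omega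
  have hbig := aS_sum h3 ht C ((S \ T).image (fun k => k + 1)) 28 (by
    intro j hj
    obtain ⟨k, hk, rfl⟩ := Finset.mem_image.1 hj
    obtain ⟨hk1, hk2⟩ := Finset.mem_sdiff.1 hk
    by_contra hc
    exact hk2 (Finset.mem_filter.2 ⟨hk1, by omega⟩))
  rw [Finset.card_image_of_injective _ (add_left_injective 1)] at hbig
  have := Finset.le_card_sdiff T S
  omega

theorem lemC {V : Type*} [Fintype V] {H : Finset (Finset V)} (h3 : IsThreeGraph H)
    (hOre : ∀ u v : V, u ≠ v → ¬ HAdj H u v →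
      Fintype.card V + 65 ≤ shadowDeg H u + shadowDeg H v)
    {t : ℕ} (ht : 10 ≤ t) (hn : Fintype.card V ≤ t + 2)
    (hno : ¬ Nonempty (BergeCycle H (t + 1)))
    (C : BergeCycle H t) {x : V} (hx : x ∉ Set.range C.vtx) (S : Finset (ZMod t))
    (hS : ∀ m ∈ S, x ∈ C.edge m) :
    28 * S.card ≤ 140 + t := by
  refine lemS h3 hOre ht hn hno C hx S C.edge C.edge_inj.injOn ?_
  intro k hk
  refine ⟨C.edge_mem k, hS k hk, C.mem_fst k, fun h => ?_⟩
  have h1 := C.edge_inj h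
  apply ne_succ ht (k - 1)
  exact h1.symm.trans (by ring)

open Classical in
theorem dC_eq {V : Type*} {H : Finset (Finset V)} {t : ℕ} [NeZero t] (C : BergeCycle H t) (x : V) :
    C.dC x = (Finset.univ.filter (fun k : ZMod t => HAdj H x (C.vtx k))).card := by
  have h : {v | v ∈ Set.range C.vtx ∧ HAdj H x v} =
      C.vtx '' ((Finset.univ.filter (fun k : ZMod t => HAdj H x (C.vtx k)) : Finset (ZMod t)) :
        Set (ZMod t)) := by
    ext v
    simp only [Set.mem_ofPred_eq, Set.mem_range, Finset.coe_filter, Finset.mem_univ, true_and,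
      Set.mem_image]
    constructor
    · rintro ⟨⟨k, rfl⟩, h⟩
      exact ⟨k, h, rfl⟩
    · rintro ⟨k, h, rfl⟩
      exact ⟨⟨k, rfl⟩, h⟩
  rw [BergeCycle.dC, h, Set.ncard_image_of_injective _ C.vtx_inj, Set.ncard_coe_finset]

theorem lemD {V : Type*} [Fintype V] {H : Finset (Finset V)} (h3 : IsThreeGraph H)
    (hOre : ∀ u v : V, u ≠ v → ¬ HAdj H u v →
      Fintype.card V + 65 ≤ shadowDeg H u + shadowDeg H v)
    {t : ℕ} (ht : 10 ≤ t) (hn : Fintype.card V ≤ t + 2)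
    (hno : ¬ Nonempty (BergeCycle H (t + 1)))
    (C : BergeCycle H t) {x : V} (hx : x ∉ Set.range C.vtx) :
    7 * C.dC x ≤ 140 + t := by
  classical
  have : NeZero t := ⟨by omega⟩
  have hxn : ∀ j, x ≠ C.vtx j := fun j h => hx ⟨j, h.symm⟩
  set A : Finset (ZMod t) := Finset.univ.filter
    (fun k => ∃ f ∈ H, x ∈ f ∧ C.vtx k ∈ f ∧ f ≠ C.edge (k - 1)) with hA
  have hch : ∀ k ∈ A, ∃ f ∈ H, x ∈ f ∧ C.vtx k ∈ f ∧ f ≠ C.edge (k - 1) :=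
    fun k hk => (Finset.mem_filter.1 hk).2
  choose! F hF1 hF2 hF3 hF4 using hch
  have h1 : C.dC x ≤ 2 * A.card := by
    rw [dC_eq]
    have hsub : Finset.univ.filter (fun k : ZMod t => HAdj H x (C.vtx k)) ⊆
        A ∪ A.image (fun k => k + 1) := by
      intro k hk
      obtain ⟨-, -, f, hf, hxf, hkf⟩ := Finset.mem_filter.1 hk
      by_cases hkA : k ∈ A
      · exact Finset.mem_union_left _ hkA
      · apply Finset.mem_union_right
        have hfe : f = C.edge (k - 1) := by
          by_contra hc
          exact hkA (Finset.mem_filter.2 ⟨Finset.mem_univ _, f, hf, hxf, hkf, hc⟩)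
        refine Finset.mem_image.2 ⟨k - 1, Finset.mem_filter.2 ⟨Finset.mem_univ _, f, hf, hxf,
          hfe ▸ C.mem_fst _, ?_⟩, by ring⟩
        rw [hfe]
        intro h
        have := C.edge_inj h
        apply ne_succ ht (k - 1 - 1)
        exact this.symm.trans (by ring)
    have h2 := (Finset.card_le_card hsub).trans (Finset.card_union_le _ _)
    have h4 : (A.image (fun k => k + 1)).card ≤ A.card := Finset.card_image_le
    omega
  have h2 : A.card ≤ 2 * (A.image F).card := by
    refine Finset.card_le_mul_card_image A 2 ?_
    intro g hg
    obtain ⟨k, hk, rfl⟩ := Finset.mem_image.1 hg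
    have h5 : (A.filter (fun a => F a = F k)).card ≤ ((F k).erase x).card := by
      refine Finset.card_le_card_of_injOn C.vtx ?_ C.vtx_inj.injOn
      intro b hb
      obtain ⟨hb1, hb2⟩ := Finset.mem_filter.1 (Finset.mem_coe.1 hb)
      exact Finset.mem_coe.2 (Finset.mem_erase.2 ⟨(hxn b).symm, hb2 ▸ hF3 b hb1⟩)
    rw [Finset.card_erase_of_mem (hF2 k hk)] at h5
    rcases h3 _ (hF1 k hk) with h | h <;> omega
  obtain ⟨S, hSA, hSi⟩ := Finset.exists_subset_injOn_image_eq_of_surjOn (f := F)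
    (A : Set (ZMod t)) (A.image F) (by
      rw [Finset.coe_image]
      exact Set.surjOn_image F _)
  have h5 : S.card = (A.image F).card := by
    rw [← hSi.2, Finset.card_image_of_injOn hSi.1]
  have h6 := lemS h3 hOre ht hn hno C hx S F hSi.1
    (fun k hk => ⟨hF1 k (hSA hk), hF2 k (hSA hk), hF3 k (hSA hk), hF4 k (hSA hk)⟩)
  omega


theorem off_deg {V : Type*} [Fintype V] {H : Finset (Finset V)} {t : ℕ} [NeZero t]
    (C : BergeCycle H t) {u x : V} (hu : u ∉ Set.range C.vtx) (hxu : ¬ HAdj H x u) :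
    shadowDeg H x + t + 1 ≤ C.dC x + Fintype.card V := by
  classical
  have hsub : {v | HAdj H x v} ⊆ {v | v ∈ Set.range C.vtx ∧ HAdj H x v} ∪
      (insert u (Set.range C.vtx))ᶜ := by
    intro v hv
    by_cases hv2 : v ∈ Set.range C.vtx
    · exact Or.inl ⟨hv2, hv⟩
    · right
      rintro (h | h)
      · subst h; exact hxu hv
      · exact hv2 h
  have h1 := (Set.ncard_le_ncard hsub (Set.toFinite _)).trans (Set.ncard_union_le _ _)
  have h2 : (insert u (Set.range C.vtx)).ncard = t + 1 := by
    rw [Set.ncard_insert_of_notMem hu (Set.toFinite _), ← Set.image_univ,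
      Set.ncard_image_of_injective _ C.vtx_inj, Set.ncard_univ, Nat.card_zmod]
  have h3 := Set.ncard_add_ncard_compl (insert u (Set.range C.vtx)) (Set.toFinite _)
    (Set.toFinite _)
  rw [Nat.card_eq_fintype_card] at h3
  unfold shadowDeg BergeCycle.dC
  omega

theorem swap {V : Type*} {H : Finset (Finset V)} {t : ℕ} (ht : 10 ≤ t)
    (C : BergeCycle H t) {x : V} (hx : x ∉ Set.range C.vtx) (j : ZMod t) {e1 e2 : Finset V}
    (h12 : e1 ≠ e2) (h1 : e1 ∈ H) (h2 : e2 ∈ H) (hx1 : x ∈ e1) (hx2 : x ∈ e2)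
    (hv1 : C.vtx (j - 1) ∈ e1) (hv2 : C.vtx (j + 1) ∈ e2)
    (hne1 : ∀ m, m ≠ j → m ≠ j - 1 → C.edge m ≠ e1)
    (hne2 : ∀ m, m ≠ j → m ≠ j - 1 → C.edge m ≠ e2) :
    ∃ C' : BergeCycle H t, C.vtx j ∉ Set.range C'.vtx ∧ C.dC (C.vtx j) ≤ C'.dC (C.vtx j) := by
  classical
  have : NeZero t := ⟨by omega⟩
  have hxn : ∀ j, C.vtx j ≠ x := fun j h => hx ⟨j, h⟩
  have hj1 : j - 1 ≠ j := fun h => ne_succ ht (j - 1) (by rw [sub_add_cancel]; exact h)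
  have hs : ∀ m : ZMod t, m + 1 = j → m = j - 1 := fun m h => eq_sub_of_add_eq h
  refine ⟨⟨fun m => if m = j then x else C.vtx m,
    fun m => if m = j - 1 then e1 else if m = j then e2 else C.edge m, ?_, ?_, ?_, ?_, ?_⟩, ?_, ?_⟩
  · intro a b hab
    dsimp only at hab
    split_ifs at hab with ha hb hb
    · exact ha.trans hb.symm
    · exact absurd hab.symm (hxn _)
    · exact absurd hab (hxn _)
    · exact C.vtx_inj hab
  · intro a b hab
    dsimp only at hab
    split_ifs at hab with ha hb hb hb hb hb hb hb
    all_goals first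
      | exact C.edge_inj hab
      | exact ha.trans hb.symm
      | exact absurd hab h12
      | exact absurd hab.symm h12
      | (rename_i q1 _; exact q1.trans hb.symm)
      | exact absurd hab (hne1 _ ‹_› ‹_›)
      | exact absurd hab (hne2 _ ‹_› ‹_›)
      | exact absurd hab.symm (hne1 _ ‹_› ‹_›)
      | exact absurd hab.symm (hne2 _ ‹_› ‹_›)
      | (subst_vars; rfl)
  · intro m
    split_ifs
    · exact h1
    · exact h2
    · exact C.edge_mem m
  · intro m
    by_cases ha : m = j
    · rw [if_pos ha, if_neg (by rw [ha]; exact hj1.symm), if_pos ha]; exact hx2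
    · by_cases hb : m = j - 1
      · simp only [if_neg ha, if_pos hb]; rw [hb]; exact hv1
      · simp only [if_neg ha, if_neg hb]; exact C.mem_fst m
  · intro m
    by_cases hb : m = j - 1
    · rw [if_pos hb, if_pos (by rw [hb]; ring)]; exact hx1
    · rw [if_neg (fun h => hb (hs m h)), if_neg hb]
      split_ifs with ha
      · rw [ha]; exact hv2
      · exact C.mem_snd m
  · rintro ⟨m, hm⟩
    dsimp only at hm
    split_ifs at hm with h
    · exact hxn _ hm.symm
    · exact h (C.vtx_inj hm)
  · unfold BergeCycle.dC
    refine Set.ncard_le_ncard ?_ ?_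
    · rintro v ⟨⟨m, rfl⟩, hv⟩
      refine ⟨⟨m, ?_⟩, hv⟩
      dsimp only
      rw [if_neg]
      rintro rfl
      exact hv.1 rfl
    · exact (Set.finite_range _).subset (fun v hv => hv.1)

theorem swapD {V : Type*} [Fintype V] {H : Finset (Finset V)} (h3 : IsThreeGraph H)
    (hOre : ∀ u v : V, u ≠ v → ¬ HAdj H u v →
      Fintype.card V + 65 ≤ shadowDeg H u + shadowDeg H v)
    {t : ℕ} (ht : 10 ≤ t) (hn : Fintype.card V ≤ t + 2)
    (hno : ¬ Nonempty (BergeCycle H (t + 1)))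
    (C : BergeCycle H t) {x : V} (hx : x ∉ Set.range C.vtx) (j : ZMod t) {e1 e2 : Finset V}
    (h12 : e1 ≠ e2) (h1 : e1 ∈ H) (h2 : e2 ∈ H) (hx1 : x ∈ e1) (hx2 : x ∈ e2)
    (hv1 : C.vtx (j - 1) ∈ e1) (hv2 : C.vtx (j + 1) ∈ e2)
    (hne1 : ∀ m, m ≠ j → m ≠ j - 1 → C.edge m ≠ e1)
    (hne2 : ∀ m, m ≠ j → m ≠ j - 1 → C.edge m ≠ e2) :
    7 * C.dC (C.vtx j) ≤ 140 + t := by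
  obtain ⟨C', h, h'⟩ := swap ht C hx j h12 h1 h2 hx1 hx2 hv1 hv2 hne1 hne2
  have := lemD h3 hOre ht hn hno C' h
  omega


theorem pathP2_abs {V : Type*} {H : Finset (Finset V)} {t : ℕ} (D : ℕ → V)
    (E : ℕ → Finset V) {p q X Y : ℕ} (hpq : p < q) (hq : q + 4 ≤ t)
    (hXY : X = t - 2 ∧ Y = t - 1 ∨ X = t - 1 ∧ Y = t - 2)
    (hD : ∀ a ≤ t, ∀ b ≤ t, D a = D b → a = b)
    (hE : ∀ a < t + 2, ∀ b < t + 2, a ≠ p → a ≠ q → b ≠ p → b ≠ q → E a = E b → a = b)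
    (hm : ∀ a < t + 2, E a ∈ H)
    (r1 : ∀ a < t, D a ∈ E a) (r2 : ∀ a, a + 1 < t → D (a + 1) ∈ E a)
    (r3 : D t ∈ E (t - 1)) (r4 : D 0 ∈ E (t - 1)) (r5 : D t ∈ E (t - 3)) (r6 : D X ∈ E t)
    (r7 : D p ∈ E t) (r8 : D Y ∈ E (t + 1)) (r9 : D q ∈ E (t + 1)) :
    ∃ σ τ : ℕ → ℕ, IsPath H (fun m => D (σ m)) (fun m => E (τ m)) t ∧ σ 0 = p + 1 ∧
      σ t = q + 1 := by
  obtain ⟨L, rfl⟩ : ∃ L, q = p + (L + 1) := ⟨q - p - 1, by omega⟩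
  obtain ⟨s, rfl⟩ : ∃ s, t = s + (p + L + 5) := ⟨t - (p + L + 5), by omega⟩
  clear hpq hq
  have w1 : s + (p + L + 5) - 1 = s + p + L + 4 := by omega
  have w2 : s + (p + L + 5) - 2 = s + p + L + 3 := by omega
  have w3 : s + (p + L + 5) - 3 = s + p + L + 2 := by omega
  rw [w1] at r3 r4
  rw [w3] at r5
  rw [w1, w2] at hXY
  have hXb : X ≤ s + p + L + 4 := by omega
  have hXb' : s + p + L + 3 ≤ X := by omega
  have hYb : Y ≤ s + p + L + 4 := by omega
  have hYb' : s + p + L + 3 ≤ Y := by omega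
  have hXYn : X ≠ Y := by omega
  obtain ⟨σ, hσ⟩ : ∃ σ : ℕ → ℕ, σ = fun m => if m < L + 1 then p + 1 + m else
      if m = L + 1 then Y else
      if m = L + 2 then X else if m < p + L + 4 then p + L + 3 - m else
      if m = p + L + 4 then s + (p + L + 5)
      else s + (p + L + 5) + 1 + (p + (L + 1)) - m := ⟨_, rfl⟩
  obtain ⟨τ, hτ⟩ : ∃ τ : ℕ → ℕ, τ = fun m => if m < L then p + 1 + m else
      if m = L then s + (p + L + 5) + 1 else
      if m = L + 1 then s + p + L + 3 else if m = L + 2 then s + (p + L + 5) else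
      if m < p + L + 3 then p + L + 2 - m
      else if m = p + L + 3 then s + p + L + 4 else if m = p + L + 4 then s + p + L + 2
      else s + (p + L + 5) + (p + (L + 1)) - m := ⟨_, rfl⟩
  have s1 : ∀ m, m < L + 1 → σ m = p + 1 + m := by
    intro m h; rw [hσ]; exact if_pos h
  have s2 : ∀ m, m = L + 1 → σ m = Y := by
    intro m h; rw [hσ]; dsimp only; rw [if_neg (by omega), if_pos (by omega)]
  have s3 : ∀ m, m = L + 2 → σ m = X := by
    intro m h; rw [hσ]; dsimp only
    rw [if_neg (by omega), if_neg (by omega), if_pos (by omega)]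
  have s4 : ∀ m, L + 2 < m → m < p + L + 4 → σ m = p + L + 3 - m := by
    intro m h h'; rw [hσ]; dsimp only
    rw [if_neg (by omega), if_neg (by omega), if_neg (by omega), if_pos (by omega)]
  have s5 : ∀ m, m = p + L + 4 → σ m = s + (p + L + 5) := by
    intro m h; rw [hσ]; dsimp only
    rw [if_neg (by omega), if_neg (by omega), if_neg (by omega), if_neg (by omega),
      if_pos (by omega)]
  have s6 : ∀ m, p + L + 4 < m → σ m = s + (p + L + 5) + 1 + (p + (L + 1)) - m := by
    intro m h; rw [hσ]; dsimp only
    rw [if_neg (by omega), if_neg (by omega), if_neg (by omega), if_neg (by omega),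
      if_neg (by omega)]
  have t1 : ∀ m, m < L → τ m = p + 1 + m := by
    intro m h; rw [hτ]; exact if_pos h
  have t2 : ∀ m, m = L → τ m = s + (p + L + 5) + 1 := by
    intro m h; rw [hτ]; dsimp only; rw [if_neg (by omega), if_pos (by omega)]
  have t3 : ∀ m, m = L + 1 → τ m = s + p + L + 3 := by
    intro m h; rw [hτ]; dsimp only
    rw [if_neg (by omega), if_neg (by omega), if_pos (by omega)]
  have t4 : ∀ m, m = L + 2 → τ m = s + (p + L + 5) := by
    intro m h; rw [hτ]; dsimp only
    rw [if_neg (by omega), if_neg (by omega), if_neg (by omega), if_pos (by omega)]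
  have t5 : ∀ m, L + 2 < m → m < p + L + 3 → τ m = p + L + 2 - m := by
    intro m h h'; rw [hτ]; dsimp only
    rw [if_neg (by omega), if_neg (by omega), if_neg (by omega), if_neg (by omega),
      if_pos (by omega)]
  have t6 : ∀ m, m = p + L + 3 → τ m = s + p + L + 4 := by
    intro m h; rw [hτ]; dsimp only
    rw [if_neg (by omega), if_neg (by omega), if_neg (by omega), if_neg (by omega),
      if_neg (by omega), if_pos (by omega)]
  have t7 : ∀ m, m = p + L + 4 → τ m = s + p + L + 2 := by
    intro m h; rw [hτ]; dsimp only
    rw [if_neg (by omega), if_neg (by omega), if_neg (by omega), if_neg (by omega),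
      if_neg (by omega), if_neg (by omega), if_pos (by omega)]
  have t8 : ∀ m, p + L + 4 < m → τ m = s + (p + L + 5) + (p + (L + 1)) - m := by
    intro m h; rw [hτ]; dsimp only
    rw [if_neg (by omega), if_neg (by omega), if_neg (by omega), if_neg (by omega),
      if_neg (by omega), if_neg (by omega), if_neg (by omega)]
  clear hσ hτ
  have hσc : ∀ m, (m < L + 1 ∧ σ m = p + 1 + m) ∨ (m = L + 1 ∧ σ m = Y) ∨
      (m = L + 2 ∧ σ m = X) ∨ (L + 2 < m ∧ m < p + L + 4 ∧ σ m = p + L + 3 - m) ∨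
      (m = p + L + 4 ∧ σ m = s + (p + L + 5)) ∨
      (p + L + 4 < m ∧ σ m = s + (p + L + 5) + 1 + (p + (L + 1)) - m) := by
    intro m
    rcases lt_trichotomy m (L + 1) with h | h | h
    · exact Or.inl ⟨h, s1 m h⟩
    · exact Or.inr (Or.inl ⟨h, s2 m h⟩)
    · rcases (Nat.succ_le_of_lt h).eq_or_lt with h | h
      · exact Or.inr (Or.inr (Or.inl ⟨h.symm, s3 m h.symm⟩))
      · rcases lt_trichotomy m (p + L + 4) with h2 | h2 | h2
        · exact Or.inr (Or.inr (Or.inr (Or.inl ⟨h, h2, s4 m h h2⟩)))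
        · exact Or.inr (Or.inr (Or.inr (Or.inr (Or.inl ⟨h2, s5 m h2⟩))))
        · exact Or.inr (Or.inr (Or.inr (Or.inr (Or.inr ⟨h2, s6 m h2⟩))))
  have hτc : ∀ m, (m < L ∧ τ m = p + 1 + m) ∨ (m = L ∧ τ m = s + (p + L + 5) + 1) ∨
      (m = L + 1 ∧ τ m = s + p + L + 3) ∨ (m = L + 2 ∧ τ m = s + (p + L + 5)) ∨
      (L + 2 < m ∧ m < p + L + 3 ∧ τ m = p + L + 2 - m) ∨
      (m = p + L + 3 ∧ τ m = s + p + L + 4) ∨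
      (m = p + L + 4 ∧ τ m = s + p + L + 2) ∨
      (p + L + 4 < m ∧ τ m = s + (p + L + 5) + (p + (L + 1)) - m) := by
    intro m
    rcases lt_trichotomy m L with h | h | h
    · exact Or.inl ⟨h, t1 m h⟩
    · exact Or.inr (Or.inl ⟨h, t2 m h⟩)
    · rcases (Nat.succ_le_of_lt h).eq_or_lt with h | h
      · exact Or.inr (Or.inr (Or.inl ⟨h.symm, t3 m h.symm⟩))
      · rcases (Nat.succ_le_of_lt h).eq_or_lt with h | h
        · exact Or.inr (Or.inr (Or.inr (Or.inl ⟨h.symm, t4 m h.symm⟩)))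
        · rcases lt_trichotomy m (p + L + 3) with h2 | h2 | h2
          · exact Or.inr (Or.inr (Or.inr (Or.inr (Or.inl ⟨h, h2, t5 m h h2⟩))))
          · exact Or.inr (Or.inr (Or.inr (Or.inr (Or.inr (Or.inl ⟨h2, t6 m h2⟩)))))
          · rcases (Nat.succ_le_of_lt h2).eq_or_lt with h2 | h2
            · exact Or.inr (Or.inr (Or.inr (Or.inr (Or.inr (Or.inr (Or.inl
                ⟨h2.symm, t7 m h2.symm⟩))))))
            · exact Or.inr (Or.inr (Or.inr (Or.inr (Or.inr (Or.inr (Or.inr ⟨h2, t8 m h2⟩))))))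
  have hσl : ∀ m ≤ s + (p + L + 5), σ m ≤ s + (p + L + 5) := by
    intro m hm
    clear hXY
    rcases hσc m with h1 | h1 | h1 | h1 | h1 | h1 <;> omega
  have hτl : ∀ m < s + (p + L + 5), τ m < s + (p + L + 5) + 2 ∧ τ m ≠ p ∧ τ m ≠ p + (L + 1) := by
    intro m hm
    clear hXY
    rcases hτc m with h1 | h1 | h1 | h1 | h1 | h1 | h1 | h1 <;>
      refine ⟨?_, ?_, ?_⟩ <;> omega
  refine ⟨σ, τ, ⟨?_, ?_, ?_, ?_, ?_⟩, s1 0 (by omega), ?_⟩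
  · intro a ha b hb hab
    have h := hD _ (hσl a ha) _ (hσl b hb) hab
    clear hXY
    rcases hσc a with h1 | h1 | h1 | h1 | h1 | h1 <;>
      rcases hσc b with h2 | h2 | h2 | h2 | h2 | h2 <;> omega
  · intro a ha b hb hab
    obtain ⟨a1, a2, a3⟩ := hτl a ha
    obtain ⟨b1, b2, b3⟩ := hτl b hb
    have h := hE _ a1 _ b1 a2 a3 b2 b3 hab
    clear hXY a1 a2 a3 b1 b2 b3
    rcases hτc a with h1 | h1 | h1 | h1 | h1 | h1 | h1 | h1 <;>
      rcases hτc b with h2 | h2 | h2 | h2 | h2 | h2 | h2 | h2 <;> omega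
  · intro m h
    exact hm _ (hτl m h).1
  · intro m h
    try dsimp only
    rcases hτc m with h1 | h1 | h1 | h1 | h1 | h1 | h1 | h1
    · rw [h1.2, s1 m (by omega)]; exact r1 _ (by omega)
    · rw [h1.2, s1 m (by omega), show p + 1 + m = p + (L + 1) by omega]; exact r9
    · rw [h1.2, s2 m (by omega)]
      rcases hXY with ⟨_, h⟩ | ⟨_, h⟩
      · rw [h]; exact r2 _ (by omega)
      · rw [h]; exact r1 _ (by omega)
    · rw [h1.2, s3 m (by omega)]; exact r6
    · rw [h1.2.2, s4 m (by omega) (by omega),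
        show p + L + 3 - m = p + L + 2 - m + 1 by omega]
      exact r2 _ (by omega)
    · by_cases hp : p = 0
      · rw [h1.2, s4 m (by omega) (by omega), show p + L + 3 - m = 0 by omega]; exact r4
      · rw [h1.2, s4 m (by omega) (by omega), show p + L + 3 - m = 0 by omega]; exact r4
    · rw [h1.2, s5 m (by omega)]; exact r5
    · rw [h1.2, s6 m (by omega), show s + (p + L + 5) + 1 + (p + (L + 1)) - m =
        s + (p + L + 5) + (p + (L + 1)) - m + 1 by omega]
      exact r2 _ (by omega)
  · intro m h
    try dsimp only
    rcases hτc m with h1 | h1 | h1 | h1 | h1 | h1 | h1 | h1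
    · rw [h1.2, s1 (m + 1) (by omega)]; exact r2 _ (by omega)
    · rw [h1.2, s2 (m + 1) (by omega)]; exact r8
    · rw [h1.2, s3 (m + 1) (by omega)]
      rcases hXY with ⟨h, _⟩ | ⟨h, _⟩
      · rw [h]; exact r1 _ (by omega)
      · rw [h]; exact r2 _ (by omega)
    · rw [h1.2, s4 (m + 1) (by omega) (by omega), show p + L + 3 - (m + 1) = p by omega]
      exact r7
    · rw [h1.2.2, s4 (m + 1) (by omega) (by omega),
        show p + L + 3 - (m + 1) = p + L + 2 - m by omega]
      exact r1 _ (by omega)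
    · rw [h1.2, s5 (m + 1) (by omega)]; exact r3
    · rw [h1.2, s6 (m + 1) (by omega), show s + (p + L + 5) + 1 + (p + (L + 1)) - (m + 1) =
        s + p + L + 2 by omega]
      exact r1 _ (by omega)
    · rw [h1.2, s6 (m + 1) (by omega), show s + (p + L + 5) + 1 + (p + (L + 1)) - (m + 1) =
        s + (p + L + 5) + (p + (L + 1)) - m by omega]
      exact r1 _ (by omega)
  · clear hXY
    rcases hσc (s + (p + L + 5)) with h1 | h1 | h1 | h1 | h1 | h1 <;> omega

theorem pathP2 {V : Type*} {H : Finset (Finset V)} {t : ℕ} (ht : 10 ≤ t)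
    (C : BergeCycle H t) {u : V} (hu : u ∉ Set.range C.vtx) (b : ZMod t)
    (hu1 : u ∈ C.edge (b - 1)) (hu3 : u ∈ C.edge (b - 3))
    {x y : ZMod t} (hxy : x = b - 2 ∧ y = b - 1 ∨ x = b - 1 ∧ y = b - 2)
    {p q : ℕ} (hpq : p < q) (hq : q + 4 ≤ t) {gx gy : Finset V} (hg : gx ≠ gy)
    (hgx : gx ∈ H) (hgy : gy ∈ H) (hx1 : C.vtx x ∈ gx) (hx2 : C.vtx (b + p) ∈ gx)
    (hy1 : C.vtx y ∈ gy) (hy2 : C.vtx (b + q) ∈ gy)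
    (hnx : ∀ k, k ≠ b + p → C.edge k ≠ gx) (hny : ∀ k, k ≠ b + q → C.edge k ≠ gy) :
    ∃ (P : ℕ → V) (f : ℕ → Finset V), IsPath H P f t ∧ P 0 = C.vtx (b + p + 1) ∧
      P t = C.vtx (b + q + 1) ∧
      ∀ m, f m = gx ∨ f m = gy ∨ ∃ j, f m = C.edge j := by
  have hun : ∀ j, C.vtx j ≠ u := fun j h => hu ⟨j, h⟩
  have hs : ∀ s : ℕ, s ≤ t → ((t - s : ℕ) : ZMod t) = - (s : ZMod t) := fun s hs =>
    cast_sub_eq (by omega)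
  obtain ⟨D, hDd⟩ : ∃ D : ℕ → V, D = fun m => if m < t then C.vtx (b + m) else u := ⟨_, rfl⟩
  obtain ⟨E, hEd⟩ : ∃ E : ℕ → Finset V, E = fun m => if m < t then C.edge (b + m) else
    if m = t then gx else gy := ⟨_, rfl⟩
  have hE0 : ∀ m < t, E m = C.edge (b + m) := fun m hm => by rw [hEd]; dsimp only; rw [if_pos hm]
  have hEx : E t = gx := by rw [hEd]; simp
  have hEy : E (t + 1) = gy := by rw [hEd]; simp
  have hD0 : ∀ m < t, D m = C.vtx (b + m) := fun m hm => by rw [hDd]; dsimp only; rw [if_pos hm]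
  have hDu : D t = u := by rw [hDd]; simp
  have hX : ∃ X Y : ℕ, (X = t - 2 ∧ Y = t - 1 ∨ X = t - 1 ∧ Y = t - 2) ∧ b + X = x ∧ b + Y = y := by
    rcases hxy with ⟨rfl, rfl⟩ | ⟨rfl, rfl⟩
    · refine ⟨t - 2, t - 1, Or.inl ⟨rfl, rfl⟩, ?_, ?_⟩ <;> rw [hs _ (by omega)] <;> push_cast <;>
        ring
    · refine ⟨t - 1, t - 2, Or.inr ⟨rfl, rfl⟩, ?_, ?_⟩ <;> rw [hs _ (by omega)] <;> push_cast <;>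
        ring
  obtain ⟨X, Y, hXY, hXx, hYy⟩ := hX
  have hXt : X < t := by omega
  have hYt : Y < t := by omega
  obtain ⟨σ, τ, hP, h0, h1⟩ : ∃ σ τ : ℕ → ℕ, IsPath H (fun m => D (σ m)) (fun m => E (τ m)) t ∧
      σ 0 = p + 1 ∧ σ t = q + 1 := by
    refine pathP2_abs (H := H) D E hpq hq hXY ?_ ?_ ?_ ?_ ?_ ?_ ?_ ?_ ?_ ?_ ?_ ?_
    · intro a ha c hc hac
      rw [hDd] at hac
      try dsimp only at hac
      split_ifs at hac with h1 h2 h2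
      · exact cast_inj_lt _ h1 h2 (C.vtx_inj hac)
      · exact absurd hac (hun _)
      · exact absurd hac.symm (hun _)
      · omega
    · have hx' : ∀ a < t, a ≠ p → C.edge (b + a) ≠ gx := fun a ha hap =>
        hnx _ (fun h => hap (cast_inj_lt b ha (by omega) h))
      have hy' : ∀ a < t, a ≠ q → C.edge (b + a) ≠ gy := fun a ha hap =>
        hny _ (fun h => hap (cast_inj_lt b ha (by omega) h))
      intro a ha c hc hap haq hcp hcq hac
      rw [hEd] at hac
      try dsimp only at hac
      split_ifs at hac
      all_goals first
        | omega
        | exact cast_inj_lt b ‹_› ‹_› (C.edge_inj hac)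
        | exact absurd hac hg
        | exact absurd hac.symm hg
        | exact absurd hac (hx' _ ‹_› ‹_›)
        | exact absurd hac (hy' _ ‹_› ‹_›)
        | exact absurd hac.symm (hx' _ ‹_› ‹_›)
        | exact absurd hac.symm (hy' _ ‹_› ‹_›)
    · intro a ha
      rw [hEd]
      try dsimp only
      split_ifs
      · exact C.edge_mem _
      · exact hgx
      · exact hgy
    · intro a h; rw [hD0 _ h, hE0 _ h]; exact C.mem_fst _
    · intro a h; rw [hD0 _ h, hE0 _ (by omega)]; push_cast; rw [← add_assoc]; exact C.mem_snd _
    · rw [hDu, hE0 _ (by omega), hs _ (by omega)]; push_cast; rw [← sub_eq_add_neg]; exact hu1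
    · rw [hD0 _ (by omega), hE0 _ (by omega), hs _ (by omega)]
      have := C.mem_snd (b - 1)
      rw [sub_add_cancel] at this
      push_cast; rw [← sub_eq_add_neg, add_zero]; exact this
    · rw [hDu, hE0 _ (by omega), hs _ (by omega)]; push_cast; rw [← sub_eq_add_neg]; exact hu3
    · rw [hD0 _ hXt, hEx, hXx]; exact hx1
    · rw [hD0 _ (by omega), hEx]; exact hx2
    · rw [hD0 _ hYt, hEy, hYy]; exact hy1
    · rw [hD0 _ (by omega), hEy]; exact hy2
  refine ⟨_, _, hP, ?_, ?_, ?_⟩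
  · try dsimp only
    rw [h0, hD0 _ (by omega)]; push_cast; rw [add_assoc]
  · try dsimp only
    rw [h1, hD0 _ (by omega)]; push_cast; rw [add_assoc]
  · intro m
    rw [hEd]
    try dsimp only
    split_ifs
    · exact Or.inr (Or.inr ⟨_, rfl⟩)
    · exact Or.inl rfl
    · exact Or.inr (Or.inl rfl)

theorem cyc2 {V : Type*} {H : Finset (Finset V)} {t : ℕ} (ht : 10 ≤ t)
    (C : BergeCycle H t) {u : V} (hu : u ∉ Set.range C.vtx) (b : ZMod t)
    (hu1 : u ∈ C.edge (b - 1)) {q : ZMod t} (hq : q ≠ b - 1) {g f : Finset V} (hgf : f ≠ g)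
    (hg : g ∈ H) (hf : f ∈ H) (hg1 : C.vtx (b - 1) ∈ g) (hg2 : C.vtx q ∈ g)
    (hf1 : u ∈ f) (hf2 : C.vtx (q + 1) ∈ f)
    (hng : ∀ k, k ≠ q → C.edge k ≠ g) (hnf : ∀ k, k ≠ q → C.edge k ≠ f) :
    Nonempty (BergeCycle H (t + 1)) := by
  have hun : ∀ j, C.vtx j ≠ u := fun j h => hu ⟨j, h⟩
  have hs : b + ((t - 1 : ℕ) : ZMod t) = b - 1 := by
    rw [cast_sub_eq (show t - 1 + 1 = t by omega)]; push_cast; ring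
  obtain ⟨a, hat, hqa⟩ := exists_lin ht b q
  have ha1 : a ≠ t - 1 := by
    rintro rfl
    exact hq (hqa.trans hs)
  have hP : IsPath H (fun m => if m = 0 then u else C.vtx (b + ((m - 1 : ℕ) : ZMod t)))
      (fun m => if m = 0 then C.edge (b + ((t - 1 : ℕ) : ZMod t)) else
        C.edge (b + ((m - 1 : ℕ) : ZMod t))) t := by
    refine ⟨?_, ?_, ?_, ?_, ?_⟩
    · intro x hx y hy hxy
      try dsimp only at hxy
      split_ifs at hxy with h1 h2 h2
      · omega
      · exact absurd hxy.symm (hun _)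
      · exact absurd hxy (hun _)
      · have := cast_inj_lt b (by omega) (by omega) (C.vtx_inj hxy)
        omega
    · intro x hx y hy hxy
      try dsimp only at hxy
      split_ifs at hxy with h1 h2 h2
      · omega
      all_goals
        have := cast_inj_lt b (by omega) (by omega) (C.edge_inj hxy)
        omega
    · intro m hm
      split_ifs
      · exact C.edge_mem _
      · exact C.edge_mem _
    · intro m hm
      split_ifs
      · rw [hs]; exact hu1
      · exact C.mem_fst _
    · intro m hm
      simp only [Nat.add_eq_zero_iff, one_ne_zero, and_false, if_false, Nat.add_sub_cancel]
      split_ifs with h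
      · subst h
        have := C.mem_snd (b - 1)
        rw [sub_add_cancel] at this
        rw [hs]; simpa using this
      · have := C.mem_snd (b + ((m - 1 : ℕ) : ZMod t))
        rw [add_assoc] at this
        have h2 : ((m - 1 : ℕ) : ZMod t) + 1 = (m : ZMod t) := by
          have : m = m - 1 + 1 := by omega
          conv_rhs => rw [this]
          push_cast; rfl
        rwa [h2] at this
  have hE : ∀ G : Finset V, (∀ k, k ≠ q → C.edge k ≠ G) → ∀ m < t, m ≠ a + 1 →
      (if m = 0 then C.edge (b + ((t - 1 : ℕ) : ZMod t)) else
        C.edge (b + ((m - 1 : ℕ) : ZMod t))) ≠ G := by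
    intro G hG m hm hma
    split_ifs with h
    · rw [hs]; exact hG _ hq.symm
    · apply hG
      rw [hqa]
      intro h2
      have := cast_inj_lt b (by omega) (by omega) h2
      omega
  refine hP.cross (j := a + 1) (by omega) hg hf hgf (hE g hng) (hE f hnf) ?_ ?_ ?_ ?_
  · simp only [Nat.add_eq_zero_iff, one_ne_zero, and_false, if_false, Nat.add_sub_cancel]
    rwa [← hqa]
  · try dsimp only
    rw [if_neg (by omega), hs]; exact hg1
  · simpa using hf1
  · simp only [Nat.add_eq_zero_iff, one_ne_zero, and_false, if_false, Nat.add_sub_cancel]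
    push_cast
    rwa [← add_assoc, ← hqa]


theorem noP2_aux {V : Type*} [Fintype V] {H : Finset (Finset V)} (h3 : IsThreeGraph H)
    (hOre : ∀ u v : V, u ≠ v → ¬ HAdj H u v →
      Fintype.card V + 65 ≤ shadowDeg H u + shadowDeg H v)
    {t : ℕ} [NeZero t] (ht : 10 ≤ t) (hn : Fintype.card V ≤ t + 2) (hn69 : 69 ≤ Fintype.card V)
    (hn1 : t + 1 ≤ Fintype.card V)
    (hno : ¬ Nonempty (BergeCycle H (t + 1)))
    (C : BergeCycle H t) {u : V} (hu : u ∉ Set.range C.vtx)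
    {P : ℕ → V} {f : ℕ → Finset V} (hP : IsPath H P f t) {a b : ZMod t}
    (hP0 : P 0 = C.vtx a) (hPt : P t = C.vtx b) {gx gy : Finset V}
    (hf : ∀ m, f m = gx ∨ f m = gy ∨ ∃ j, f m = C.edge j)
    (ha : ¬ HAdj H u (C.vtx a)) (hb : ¬ HAdj H u (C.vtx b))
    (hsa : 3 * (aS C a).card < Fintype.card V) (hsb : 3 * (aS C b).card < Fintype.card V) :
    False := by
  classical
  have hun : ∀ j, u ≠ C.vtx j := fun j h => hu ⟨j, h.symm⟩
  have h1 := hOre _ _ (hun a) ha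
  have h1' := hOre _ _ (hun b) hb
  have h2 := hP.ore h3 (by omega) hno
  have h4 := alpha_le C hP (fun m _ => hf m) a hP0
  have h5 := alpha_le C hP (fun m _ => hf m) b hPt
  have h6 := shadow_le_path hP (P 0)
  have h7 := shadow_le_path hP (P t)
  have h8 := lemD h3 hOre ht hn hno C hu
  have h9 : shadowDeg H u + t + 1 ≤ C.dC u + Fintype.card V :=
    off_deg C hu (fun h => h.1 rfl)
  rw [← hP0] at h1
  rw [← hPt] at h1'
  omega

theorem noP2 {V : Type*} [Fintype V] {H : Finset (Finset V)} (h3 : IsThreeGraph H)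
    (hOre : ∀ u v : V, u ≠ v → ¬ HAdj H u v →
      Fintype.card V + 65 ≤ shadowDeg H u + shadowDeg H v)
    {t : ℕ} [NeZero t] (ht : 10 ≤ t) (hn : Fintype.card V ≤ t + 2) (hn69 : 69 ≤ Fintype.card V)
    (hn1 : t + 1 ≤ Fintype.card V)
    (hno : ¬ Nonempty (BergeCycle H (t + 1)))
    (C : BergeCycle H t) {u : V} (hu : u ∉ Set.range C.vtx) (i : ZMod t)
    (hu1 : u ∈ C.edge (i + 1)) (hu3 : u ∈ C.edge (i - 1))
    {p q : ZMod t} (hpq : p ≠ q) (hp1 : p ≠ i - 1) (hp2 : p ≠ i) (hp3 : p ≠ i + 1)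
    (hq1 : q ≠ i - 1) (hq2 : q ≠ i) (hq3 : q ≠ i + 1) {gx gy : Finset V} (hg : gx ≠ gy)
    (hgx : gx ∈ H) (hgy : gy ∈ H) (hx1 : C.vtx i ∈ gx) (hx2 : C.vtx p ∈ gx)
    (hy1 : C.vtx (i + 1) ∈ gy) (hy2 : C.vtx q ∈ gy)
    (hnx : ∀ k, k ≠ p → C.edge k ≠ gx) (hny : ∀ k, k ≠ q → C.edge k ≠ gy)
    (ha : ¬ HAdj H u (C.vtx (p + 1))) (hb : ¬ HAdj H u (C.vtx (q + 1)))
    (hsa : 3 * (aS C (p + 1)).card < Fintype.card V)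
    (hsb : 3 * (aS C (q + 1)).card < Fintype.card V) :
    False := by
  have hs : ∀ s : ℕ, s ≤ t → ((t - s : ℕ) : ZMod t) = - (s : ZMod t) := fun s hs =>
    cast_sub_eq (by omega)
  have e1 : i + 2 - 1 = i + 1 := by ring
  have e2 : i + 2 - 2 = i := by ring
  have e3 : i + 2 - 3 = i - 1 := by ring
  have hlin : ∀ r : ZMod t, r ≠ i - 1 → r ≠ i → r ≠ i + 1 → ∃ m : ℕ, m + 4 ≤ t ∧ r = i + 2 + m := by
    intro r h1 h2 h4
    obtain ⟨m, hm, hr⟩ := exists_lin ht (i + 2) r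
    refine ⟨m, ?_, hr⟩
    have m1 : m ≠ t - 1 := by
      rintro rfl
      rw [hs _ (by omega)] at hr; push_cast at hr
      exact h4 (by rw [hr]; ring)
    have m2 : m ≠ t - 2 := by
      rintro rfl
      rw [hs _ (by omega)] at hr; push_cast at hr
      exact h2 (by rw [hr]; ring)
    have m3 : m ≠ t - 3 := by
      rintro rfl
      rw [hs _ (by omega)] at hr; push_cast at hr
      exact h1 (by rw [hr]; ring)
    omega
  obtain ⟨a, hat, rfl⟩ := hlin p hp1 hp2 hp3
  obtain ⟨b, hbt, rfl⟩ := hlin q hq1 hq2 hq3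
  rcases lt_trichotomy a b with hab | hab | hab
  · obtain ⟨P, f, hP, hP0, hPt, hf⟩ := pathP2 ht C hu (i + 2) (by rw [e1]; exact hu1)
      (by rw [e3]; exact hu3) (x := i) (y := i + 1) (Or.inl ⟨e2.symm, e1.symm⟩) hab hbt hg
      hgx hgy hx1 hx2 hy1 hy2 hnx hny
    exact noP2_aux h3 hOre ht hn hn69 hn1 hno C hu hP hP0 hPt hf ha hb hsa hsb
  · subst hab; exact hpq rfl
  · obtain ⟨P, f, hP, hP0, hPt, hf⟩ := pathP2 ht C hu (i + 2) (by rw [e1]; exact hu1)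
      (by rw [e3]; exact hu3) (x := i + 1) (y := i) (Or.inr ⟨e1.symm, e2.symm⟩) hab hat hg.symm
      hgy hgx hy1 hy2 hx1 hx2 hny hnx
    exact noP2_aux h3 hOre ht hn hn69 hn1 hno C hu hP hP0 hPt hf hb ha hsb hsa

open Classical in
noncomputable def setA {V : Type*} {H : Finset (Finset V)} {t : ℕ} [NeZero t]
    (C : BergeCycle H t) (i : ZMod t) (x : V) : Finset (ZMod t) :=
  Finset.univ.filter (fun p => p ≠ i - 1 ∧ C.vtx p ∉ C.edge i ∧
    ∃ g ∈ H, x ∈ g ∧ C.vtx p ∈ g ∧ g ≠ C.edge (p - 1))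

theorem setA_card {V : Type*} {H : Finset (Finset V)} (h3 : IsThreeGraph H) {t : ℕ} [NeZero t]
    (ht : 10 ≤ t) (C : BergeCycle H t) (i : ZMod t) (x : V) :
    C.dC x ≤ 2 * (setA C i x).card + 6 := by
  classical
  set K : Finset (ZMod t) :=
    (Finset.univ.filter (fun k => C.vtx k ∈ C.edge i)) \ {i, i + 1} with hK
  have hKc : K.card ≤ 1 := by
    have h1 : K.card ≤ (((C.edge i).erase (C.vtx i)).erase (C.vtx (i + 1))).card := by
      refine Finset.card_le_card_of_injOn C.vtx ?_ C.vtx_inj.injOn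
      intro k hk
      obtain ⟨hk1, hk2⟩ := Finset.mem_sdiff.1 (Finset.mem_coe.1 hk)
      have hk3 := (Finset.mem_filter.1 hk1).2
      simp only [Finset.mem_insert, Finset.mem_singleton, not_or] at hk2
      exact Finset.mem_coe.2 (Finset.mem_erase.2 ⟨fun h => hk2.2 (C.vtx_inj h),
        Finset.mem_erase.2 ⟨fun h => hk2.1 (C.vtx_inj h), hk3⟩⟩)
    have hne : C.vtx (i + 1) ≠ C.vtx i := fun h => ne_succ ht i (C.vtx_inj h).symm
    rw [Finset.card_erase_of_mem (Finset.mem_erase.2 ⟨hne, C.mem_snd i⟩),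
      Finset.card_erase_of_mem (C.mem_fst i)] at h1
    rcases h3 _ (C.edge_mem i) with h | h <;> omega
  have hKm : ∀ k, C.vtx k ∈ C.edge i → k = i ∨ k = i + 1 ∨ k ∈ K := by
    intro k hk
    by_cases h1 : k = i
    · exact Or.inl h1
    · by_cases h2 : k = i + 1
      · exact Or.inr (Or.inl h2)
      · exact Or.inr (Or.inr (Finset.mem_sdiff.2 ⟨Finset.mem_filter.2 ⟨Finset.mem_univ _, hk⟩,
          by simp [h1, h2]⟩))
  rw [dC_eq]
  have hsub : Finset.univ.filter (fun k : ZMod t => HAdj H x (C.vtx k)) ⊆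
      (setA C i x ∪ (setA C i x).image (fun k => k + 1)) ∪
        (({i - 1, i, i + 1, i + 2} : Finset (ZMod t)) ∪ (K ∪ K.image (fun k => k + 1))) := by
    intro k hk
    obtain ⟨-, -, g, hg, hxg, hkg⟩ := Finset.mem_filter.1 hk
    simp only [Finset.mem_union, Finset.mem_image, Finset.mem_insert, Finset.mem_singleton]
    by_cases hk1 : k = i - 1
    · right; left; left; exact hk1
    by_cases hk2 : C.vtx k ∈ C.edge i
    · rcases hKm k hk2 with h | h | h
      · right; left; right; left; exact h
      · right; left; right; right; left; exact h
      · right; right; left; exact h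
    by_cases hge : g = C.edge (k - 1)
    · by_cases hk3 : k - 1 = i - 1
      · right; left; right; left
        calc k = k - 1 + 1 := by ring
          _ = i := by rw [hk3]; ring
      by_cases hk4 : C.vtx (k - 1) ∈ C.edge i
      · rcases hKm _ hk4 with h | h | h
        · right; left; right; right; left
          rw [← h]; ring
        · right; left; right; right; right
          calc k = k - 1 + 1 := by ring
            _ = i + 2 := by rw [h]; ring
        · right; right; right; exact ⟨_, h, by ring⟩
      · left; right
        refine ⟨k - 1, Finset.mem_filter.2 ⟨Finset.mem_univ _, hk3, hk4, g, hg, hxg,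
          hge ▸ C.mem_fst _, ?_⟩, by ring⟩
        rw [hge]
        intro h
        have := C.edge_inj h
        apply ne_succ ht (k - 1 - 1)
        exact this.symm.trans (by ring)
    · left; left
      exact Finset.mem_filter.2 ⟨Finset.mem_univ _, hk1, hk2, g, hg, hxg, hkg, hge⟩
  have h1 := Finset.card_le_card hsub
  have h2 := Finset.card_union_le (setA C i x ∪ (setA C i x).image (fun k => k + 1))
        (({i - 1, i, i + 1, i + 2} : Finset (ZMod t)) ∪ (K ∪ K.image (fun k => k + 1)))
  have h4 := Finset.card_union_le (setA C i x) ((setA C i x).image (fun k => k + 1))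
  have h5 := Finset.card_union_le ({i - 1, i, i + 1, i + 2} : Finset (ZMod t))
    (K ∪ K.image (fun k => k + 1))
  have h6 := Finset.card_union_le K (K.image (fun k => k + 1))
  have h7 : (K.image (fun k => k + 1)).card ≤ K.card := Finset.card_image_le
  have h8 : ((setA C i x).image (fun k => k + 1)).card ≤ (setA C i x).card :=
    Finset.card_image_le
  have h9 : ({i - 1, i, i + 1, i + 2} : Finset (ZMod t)).card ≤ 4 := Finset.card_le_four
  omega

theorem caseStar {V : Type*} [Fintype V] {H : Finset (Finset V)} (h3 : IsThreeGraph H)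
    (hOre : ∀ u v : V, u ≠ v → ¬ HAdj H u v →
      Fintype.card V + 65 ≤ shadowDeg H u + shadowDeg H v)
    {t : ℕ} [NeZero t] (ht : 10 ≤ t) (hn : Fintype.card V ≤ t + 2) (hn69 : 69 ≤ Fintype.card V)
    (hn1 : t + 1 ≤ Fintype.card V)
    (hno : ¬ Nonempty (BergeCycle H (t + 1)))
    (C : BergeCycle H t) {u : V} (hu : u ∉ Set.range C.vtx) (i : ZMod t)
    (hu1 : u ∈ C.edge (i + 1)) (hu3 : u ∈ C.edge (i - 1))
    (hdi : Fintype.card V + 59 ≤ 2 * C.dC (C.vtx i))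
    (hdw : Fintype.card V + 72 ≤ 4 * C.dC (C.vtx (i + 1))) : False := by
  classical
  have hun : ∀ j, u ≠ C.vtx j := fun j h => hu ⟨j, h.symm⟩
  have hvn : ∀ {a b}, a ≠ b → C.vtx a ≠ C.vtx b := fun hab h => hab (C.vtx_inj h)
  have hdu := lemD h3 hOre ht hn hno C hu
  set Hv : Finset (ZMod t) := Finset.univ.filter
    (fun j => Fintype.card V ≤ 3 * (aS C j).card) with hHv
  have hHc : Hv.card ≤ 2 := by
    have h1 := aS_sum h3 ht C Hv ((Fintype.card V + 2) / 3) (by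
      intro j hj
      have := (Finset.mem_filter.1 hj).2
      omega)
    by_contra hc
    have h2 : 3 * ((Fintype.card V + 2) / 3) ≤ Hv.card * ((Fintype.card V + 2) / 3) :=
      Nat.mul_le_mul_right _ (by omega)
    omega
  have hHm : ∀ j, j ∉ Hv → 3 * (aS C j).card < Fintype.card V := by
    intro j hj
    by_contra hc
    exact hj (Finset.mem_filter.2 ⟨Finset.mem_univ _, by omega⟩)
  -- neighbours of u
  have hni : HAdj H u (C.vtx i) :=
    ⟨hun _, _, C.edge_mem (i - 1), hu3, by have := C.mem_snd (i - 1); rwa [sub_add_cancel] at this⟩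
  have hnw : HAdj H u (C.vtx (i + 1)) := ⟨hun _, _, C.edge_mem (i + 1), hu1, C.mem_fst _⟩
  have hni2 : HAdj H u (C.vtx (i + 1 + 1)) := ⟨hun _, _, C.edge_mem (i + 1), hu1, C.mem_snd _⟩
  have hprops : ∀ x : V, ∀ p ∈ setA C i x, p ≠ i - 1 ∧ p ≠ i ∧ p ≠ i + 1 ∧ C.vtx p ∉ C.edge i ∧
      ∃ g ∈ H, x ∈ g ∧ C.vtx p ∈ g ∧ g ≠ C.edge (p - 1) := by
    intro x p hp
    obtain ⟨-, h1, h2, h4⟩ := Finset.mem_filter.1 hp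
    refine ⟨h1, ?_, ?_, h2, h4⟩
    · rintro rfl; exact h2 (C.mem_fst _)
    · rintro rfl; exact h2 (C.mem_snd _)
  have hcard1 := setA_card h3 ht C i (C.vtx i)
  have hcard2 := setA_card h3 ht C i (C.vtx (i + 1))
  -- good p
  have hp : ∃ p ∈ setA C i (C.vtx i), p + 1 ∉ Hv ∧ ¬ HAdj H u (C.vtx (p + 1)) := by
    by_contra hc
    push Not at hc
    set N : Finset (ZMod t) := Finset.univ.filter (fun k : ZMod t => HAdj H u (C.vtx k)) with hN
    have hNc : N.card = C.dC u := (dC_eq C u).symm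
    have hT : ({i, i + 1, i + 1 + 1} : Finset (ZMod t)) ⊆ N := by
      intro k hk
      simp only [Finset.mem_insert, Finset.mem_singleton] at hk
      rcases hk with rfl | rfl | rfl
      · exact Finset.mem_filter.2 ⟨Finset.mem_univ _, hni⟩
      · exact Finset.mem_filter.2 ⟨Finset.mem_univ _, hnw⟩
      · exact Finset.mem_filter.2 ⟨Finset.mem_univ _, hni2⟩
    have hTc : ({i, i + 1, i + 1 + 1} : Finset (ZMod t)).card = 3 := by
      refine Finset.card_eq_three.2 ⟨i, i + 1, i + 1 + 1, ne_succ ht i, ?_, ne_succ ht _, rfl⟩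
      intro h
      refine zne (t := t) (a := 2) (by omega) (by omega) ?_
      push_cast
      have : i + 0 = i + (1 + 1) := by rw [add_zero, ← add_assoc]; exact h
      have := add_left_cancel this
      rw [this]; ring
    have hsub : (setA C i (C.vtx i)).image (fun k => k + 1) ⊆
        Hv ∪ (N \ {i, i + 1, i + 1 + 1}) := by
      intro k hk
      obtain ⟨p, hp, rfl⟩ := Finset.mem_image.1 hk
      obtain ⟨h1, h2, h4, -⟩ := hprops _ p hp
      rw [Finset.mem_union]
      by_cases h5 : p + 1 ∈ Hv
      · exact Or.inl h5
      · right
        refine Finset.mem_sdiff.2 ⟨Finset.mem_filter.2 ⟨Finset.mem_univ _, hc p hp h5⟩, ?_⟩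
        simp only [Finset.mem_insert, Finset.mem_singleton, not_or]
        exact ⟨fun h => h1 (eq_sub_of_add_eq h), fun h => h2 (add_right_cancel h),
          fun h => h4 (add_right_cancel h)⟩
    have h1 := (Finset.card_le_card hsub).trans (Finset.card_union_le _ _)
    rw [Finset.card_image_of_injective _ (add_left_injective 1),
      Finset.card_sdiff_of_subset hT, hTc, hNc] at h1
    have h2 := Finset.card_le_card hT
    rw [hTc, hNc] at h2
    omega
  obtain ⟨p, hpA, hpH, hpu⟩ := hp
  obtain ⟨hp1, hp2, hp3, hp4, gx, hgx, hx1, hx2, hx3⟩ := hprops _ p hpA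
  have hnx : ∀ k, k ≠ p → C.edge k ≠ gx := by
    rintro k hk rfl
    rcases on_edge h3 ht C hp2.symm hx1 hx2 with h | h | h | h
    · rw [h] at hp4; exact hp4 hx2
    · have hk2 : k = i - 1 := eq_sub_of_add_eq h.symm
      rw [hk2] at hx2
      rcases off_edge h3 ht C hu hu3 hx2 with h4 | h4
      · exact hp1 h4
      · rw [sub_add_cancel] at h4; exact hp2 h4
    · exact hk h.symm
    · apply hx3; rw [h]; congr 1; ring
  have hwprop : ∀ q ∈ setA C i (C.vtx (i + 1)), ∃ g ∈ H, C.vtx (i + 1) ∈ g ∧ C.vtx q ∈ g ∧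
      ∀ k, k ≠ q → C.edge k ≠ g := by
    intro q hq
    obtain ⟨hq1, hq2, hq3, hq4, g, hg, hy1, hy2, hy3⟩ := hprops _ q hq
    refine ⟨g, hg, hy1, hy2, ?_⟩
    rintro k hk rfl
    rcases on_edge h3 ht C hq3.symm hy1 hy2 with h | h | h | h
    · rw [← h] at hy2 hy3
      rcases off_edge h3 ht C hu hu1 hy2 with h4 | h4
      · exact hq3 h4
      · apply hy3; rw [h4]; congr 1; ring
    · rw [← add_right_cancel h] at hy2; exact hq4 hy2
    · exact hk h.symm
    · apply hy3; rw [h]; congr 1; ring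
  have hq : ∃ q ∈ setA C i (C.vtx (i + 1)), q ≠ p ∧ q + 1 ∉ Hv ∧ ¬ HAdj H u (C.vtx (q + 1)) := by
    by_contra hc
    push Not at hc
    set M : Finset (ZMod t) := Finset.univ.filter (fun k : ZMod t => u ∈ C.edge k) with hM
    have hMc := lemC h3 hOre ht hn hno C hu M (fun m hm => (Finset.mem_filter.1 hm).2)
    have hsub : ((setA C i (C.vtx (i + 1))).erase p).image (fun k => k + 1) ⊆ Hv ∪ M := by
      intro k hk
      obtain ⟨q, hq', rfl⟩ := Finset.mem_image.1 hk
      obtain ⟨hqp, hq⟩ := Finset.mem_erase.1 hq'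
      obtain ⟨hq1, hq2, hq3, -⟩ := hprops _ q hq
      rw [Finset.mem_union]
      by_cases h5 : q + 1 ∈ Hv
      · exact Or.inl h5
      right
      refine Finset.mem_filter.2 ⟨Finset.mem_univ _, ?_⟩
      obtain ⟨-, f, hf, huf, hqf⟩ := hc q hq hqp h5
      obtain ⟨g, hg, hy1, hy2, hng⟩ := hwprop q hq
      by_contra hcon
      have e1 : i + 2 - 1 = i + 1 := by ring
      refine hno (cyc2 ht C hu (i + 2) (q := q) (g := g) (f := f) (by rw [e1]; exact hu1)
        (by rw [e1]; exact hq3) ?_ hg hf (by rw [e1]; exact hy1) hy2 huf hqf hng ?_)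
      · rintro rfl
        exact card4 h3 hf huf hqf hy1 hy2 (hun _) (hun _) (hun _)
          (hvn (fun h => hq2 (add_right_cancel h))) (hvn (ne_succ ht q).symm) (hvn hq3.symm)
      · rintro k hk rfl
        rcases off_edge h3 ht C hu huf hqf with h | h
        · rw [h] at hcon; exact hcon huf
        · exact hk (add_right_cancel h).symm
    have h1 := (Finset.card_le_card hsub).trans (Finset.card_union_le _ _)
    rw [Finset.card_image_of_injective _ (add_left_injective 1)] at h1
    have h2 := Finset.pred_card_le_card_erase (s := setA C i (C.vtx (i + 1))) (a := p)
    omega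
  obtain ⟨q, hqA, hqp, hqH, hqu⟩ := hq
  obtain ⟨hq1, hq2, hq3, -⟩ := hprops _ q hqA
  obtain ⟨gy, hgy, hy1, hy2, hny⟩ := hwprop q hqA
  refine noP2 h3 hOre ht hn hn69 hn1 hno C hu i hu1 hu3 hqp.symm hp1 hp2 hp3 hq1 hq2 hq3 ?_
    hgx hgy hx1 hx2 hy1 hy2 hnx hny hpu hqu (hHm _ hpH) (hHm _ hqH)
  rintro rfl
  exact card4 h3 hgx hx1 hx2 hy1 hy2 (hvn hp2.symm) (hvn (ne_succ ht i)) (hvn hq2.symm)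
    (hvn hp3) (hvn hqp.symm) (hvn hq3.symm)

/-- Claim 8: for `v_i ∈ U_u ∩ B₁(C)`, the vertex `v_{i+1}`
lies in `B'(C) ∪ S'(C)`, i.e. `d_C(v_{i+1}) ≥ 3n/4 + 13` or
`d_C(v_{i+1}) < n/4 + 18`. -/
theorem stmt16 {V : Type*} [Fintype V] (n : ℕ) (hn : 69 ≤ n)
    (hcard : Fintype.card V = n) (H : Finset (Finset V)) (h3 : IsThreeGraph H)
    (hOre : ∀ u v : V, u ≠ v → ¬ HAdj H u v →
      n + 65 ≤ shadowDeg H u + shadowDeg H v)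
    (hnoham : ¬ HamiltonianBergeCycle H)
    {t : ℕ} (C : BergeCycle H t)
    (hlong : ∀ (t' : ℕ) (C' : BergeCycle H t'), t' ≤ t)
    (ht : t = n - 1 ∨ t = n - 2)
    (u : V) (hu : u ∉ Set.range C.vtx)
    (U : Set (ZMod t)) (hU : Usable C u U) (hUcard : (C.dC u : ℚ) / 6 ≤ U.ncard)
    (i : ZMod t) (hi : i ∈ U)
    (hiB1 : (n + 65 : ℚ) / 2 - 3 ≤ (C.dC (C.vtx i) : ℚ) ∧
      (C.dC (C.vtx i) : ℚ) < 3 * (n : ℚ) / 4 + 13) :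
    3 * (n : ℚ) / 4 + 13 ≤ (C.dC (C.vtx (i + 1)) : ℚ) ∨
      (C.dC (C.vtx (i + 1)) : ℚ) < (n : ℚ) / 4 + 18 := by
  subst hcard
  have ht10 : 10 ≤ t := by omega
  have : NeZero t := ⟨by omega⟩
  have hn2 : Fintype.card V ≤ t + 2 := by omega
  have hn1 : t + 1 ≤ Fintype.card V := by omega
  have hno : ¬ Nonempty (BergeCycle H (t + 1)) := by
    rintro ⟨C'⟩
    have := hlong _ C'
    omega
  by_contra hcon
  push Not at hcon
  obtain ⟨hcon1, hcon2⟩ := hcon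
  have hdw' : 4 * C.dC (C.vtx (i + 1)) < 3 * Fintype.card V + 52 := by
    have : 4 * (C.dC (C.vtx (i + 1)) : ℚ) < 3 * Fintype.card V + 52 := by linarith
    exact_mod_cast this
  have hdi' : 4 * C.dC (C.vtx i) < 3 * Fintype.card V + 52 := by
    have : 4 * (C.dC (C.vtx i) : ℚ) < 3 * Fintype.card V + 52 := by linarith [hiB1.2]
    exact_mod_cast this
  have hdw : Fintype.card V + 72 ≤ 4 * C.dC (C.vtx (i + 1)) := by
    have : (Fintype.card V : ℚ) + 72 ≤ 4 * C.dC (C.vtx (i + 1)) := by linarith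
    exact_mod_cast this
  have hdi : Fintype.card V + 59 ≤ 2 * C.dC (C.vtx i) := by
    have : (Fintype.card V : ℚ) + 59 ≤ 2 * C.dC (C.vtx i) := by linarith [hiB1.1]
    exact_mod_cast this
  have hun : ∀ j, u ≠ C.vtx j := fun j h => hu ⟨j, h.symm⟩
  have hvn : ∀ {a b}, a ≠ b → C.vtx a ≠ C.vtx b := fun hab h => hab (C.vtx_inj h)
  have hdu := lemD h3 hOre ht10 hn2 hno C hu
  have hdu2 : shadowDeg H u + t + 1 ≤ C.dC u + Fintype.card V :=
    off_deg C hu (fun h => h.1 rfl)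
  have hsymm : ∀ x, HAdj H x u → HAdj H u x := fun x ⟨h, e, he, h1, h2⟩ => ⟨h.symm, e, he, h2, h1⟩
  -- upper bound for degrees of `v_i` and `w`: a non-neighbour of `u` has huge degree
  have hadj : ∀ j, 4 * C.dC (C.vtx j) < 3 * Fintype.card V + 52 → HAdj H u (C.vtx j) := by
    intro j hj
    by_contra hc
    have h1 := hOre _ _ (hun j) hc
    have h2 := off_deg C hu (x := C.vtx j) (fun h => hc (hsymm _ h))
    omega
  have hui := hadj i hdi'
  have huw := hadj (i + 1) hdw'
  have eii : i - 1 + 1 = i := sub_add_cancel i 1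
  have hi1 : i - 1 ≠ i := fun h => ne_succ ht10 (i - 1) (by rw [eii]; exact h)
  have hiw : i ≠ i + 1 := ne_succ ht10 i
  have hi1w : i - 1 ≠ i + 1 := by
    intro h
    refine zne (t := t) (a := 2) (by omega) (by omega) ?_
    push_cast
    have : i + 1 - (i - 1) = (2 : ZMod t) := by ring
    rw [← this, h, sub_self]
  obtain ⟨e, he, hee, hue, hve⟩ := hU.1 i hi
  have hne : ∀ m, m ≠ i - 1 → C.edge m ≠ e := by
    rintro m hm rfl
    rcases off_edge h3 ht10 C hu hue hve with h | h
    · exact hm h.symm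
    · apply hee
      congr 1
      have : m = i - 1 - 1 := eq_sub_of_add_eq h.symm
      rw [this]; ring
  have hswapi : ∀ e2 ∈ H, e ≠ e2 → u ∈ e2 → C.vtx (i + 1) ∈ e2 →
      (∀ m, m ≠ i → m ≠ i - 1 → C.edge m ≠ e2) → False := by
    intro e2 he2 hee2 hu2 hv2 hne2
    have := swapD h3 hOre ht10 hn2 hno C hu i hee2 he he2 hue hu2 hve hv2
      (fun m _ hm => hne m hm) hne2
    omega
  by_cases huei : u ∈ C.edge i
  · exact hswapi _ (C.edge_mem i) (fun h => hne i hi1.symm h.symm) huei (C.mem_snd i)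
      (fun m hm _ h => hm (C.edge_inj h))
  obtain ⟨-, f2, hf2, huf2, hif2⟩ := hui
  have hf2e : f2 = e := by
    by_contra hc
    refine hno ((path0 ht10 C hu (i - 1) he hue hve hne).close hf2 ?_ ?_ ?_)
    · intro m hm
      try dsimp only
      split_ifs with h
      · intro h4
        rw [← h4] at huf2 hif2
        rw [eii] at huf2 hif2
        have hval : i + (m : ZMod t) = i - 1 := by
          rcases off_edge h3 ht10 C hu huf2 hif2 with h5 | h5
          · rw [← h5] at huf2; exact absurd huf2 huei
          · exact eq_sub_of_add_eq h5.symm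
        have hlast : i + ((t - 1 : ℕ) : ZMod t) = i - 1 := by
          rw [cast_sub_eq (show t - 1 + 1 = t by omega)]; push_cast; ring
        have := cast_inj_lt i (by omega) (by omega) (hval.trans hlast.symm)
        omega
      · exact fun h => hc h.symm
    · try dsimp only
      rw [if_pos (by omega), eii]; simpa using hif2
    · try dsimp only
      rw [if_neg (by omega)]; exact huf2
  subst hf2e
  obtain ⟨-, f, hf, huf, hwf⟩ := huw
  have hfe : f2 ≠ f := by
    rintro rfl
    exact card4 h3 he hue hve hif2 hwf (hun _) (hun _) (hun _) (hvn hi1) (hvn hi1w) (hvn hiw)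
  by_cases hfC : ∃ m, C.edge m = f
  swap
  · push Not at hfC
    exact hswapi f hf hfe huf hwf (fun m _ _ => hfC m)
  obtain ⟨m, rfl⟩ := hfC
  have hm : m = i + 1 := by
    rcases off_edge h3 ht10 C hu huf hwf with h | h
    · exact h.symm
    · rw [← add_right_cancel h] at huf; exact absurd huf huei
  subst hm
  by_cases heC : C.edge (i - 1) = f2
  · subst heC
    exact caseStar h3 hOre ht10 hn2 hn hn1 hno C hu i huf hue hdi hdw
  · have hnee : ∀ m, C.edge m ≠ f2 := by
      intro m
      by_cases hm : m = i - 1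
      · rw [hm]; exact heC
      · exact hne m hm
    have := swapD h3 hOre ht10 hn2 hno C hu (i + 1) hfe he hf hue huf
      (by rw [add_sub_cancel_right]; exact hif2) (C.mem_snd _) (fun m _ _ => hnee m)
      (fun m hm _ h => hm (C.edge_inj h))
    omega
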